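/- Let α ∈ ℂ be transcendental over ℚ. Let L be a differential field extension of ℂ(t) with derivation D, K a differential subfield of L, n ≥ 2, and let y₁, …, yₙ ∈ L be solutions of the second Painlevé equation y'' = 2y³ + t·y + α. If the 2n elements y₁, y₁', …, yₙ, yₙ' are NOT algebraically independent over K, then there exist indices 1 ≤ i < j ≤ n such that the four elements yᵢ, yᵢ', yⱼ, yⱼ' are not algebraically independent over K. (Geometric triviality of generic P_II; Proposition 3.6.) -/

import Mathlib

namespace PainleveII
open Polynomial

/-- A derivation of a commutative ring, as a bare additive map satisfying the Leibniz rule. -/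
structure Deriv (A : Type*) [CommRing A] extends A →+ A where
  leibniz' : ∀ a b : A, toFun (a * b) = a * toFun b + b * toFun a

namespace Deriv
variable {A : Type*} [CommRing A]

instance : FunLike (Deriv A) A A where
  coe d := d.toFun
  coe_injective := by
    rintro ⟨d, _⟩ ⟨d', _⟩ h
    congr
    exact AddMonoidHom.ext fun a => congrFun h a

instance : AddMonoidHomClass (Deriv A) A A where
  map_add d := d.map_add'
  map_zero d := d.map_zero'

variable (d : Deriv A)

lemma leibniz (a b : A) : d (a * b) = a * d b + b * d a := d.leibniz' a b

@[simp]
lemma map_one : d 1 = 0 := by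
  have := d.leibniz 1 1
  simpa using this

lemma leibniz_pow (a : A) (n : ℕ) : d (a ^ n) = n * a ^ (n - 1) * d a := by
  induction n with
  | zero => simp
  | succ n ih =>
    rw [pow_succ, leibniz, ih]
    cases n <;> (simp; try ring)

@[simp]
lemma map_natCast (n : ℕ) : d n = 0 := by
  induction n with
  | zero => simp
  | succ n ih => simp [ih]

@[simp]
lemma map_intCast (n : ℤ) : d n = 0 := by
  cases n <;> simp

@[simp]
lemma map_ofNat (n : ℕ) [n.AtLeastTwo] : d ofNat(n) = 0 := map_natCast d n

lemma map_inv {F : Type*} [Field F] (d : Deriv F) (a : F) : d a⁻¹ = -(d a / a ^ 2) := by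
  by_cases ha : a = 0
  · simp [ha]
  have := d.leibniz a a⁻¹
  rw [mul_inv_cancel₀ ha, map_one] at this
  field_simp at this ⊢
  linear_combination -this

end Deriv

section CoeffDeriv
variable {A : Type*} [CommRing A]

/-- The derivation of `A[X]` acting as `d` on coefficients and killing `X`. -/
noncomputable def coeffDeriv (d : Deriv A) : Deriv A[X] :=
  have hc : ∀ (q : A[X]) (n : ℕ),
      (∑ i ∈ Finset.range (q.natDegree + 1), monomial i (d (q.coeff i))).coeff n =
        d (q.coeff n) := by
    intro q n
    simp only [finsetSum_coeff, coeff_monomial, Finset.sum_ite_eq', Finset.mem_range]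
    split_ifs with h
    · rfl
    · rw [coeff_eq_zero_of_natDegree_lt (by omega), map_zero]
  { toFun := fun q => ∑ i ∈ Finset.range (q.natDegree + 1), monomial i (d (q.coeff i))
    map_zero' := by ext n; rw [hc]; simp
    map_add' := fun p q => by ext n; rw [coeff_add, hc, hc, hc, coeff_add, map_add]
    leibniz' := fun p q => by
      ext n
      rw [mul_comm q, coeff_add, hc, coeff_mul, coeff_mul, coeff_mul, map_sum,
        ← Finset.sum_add_distrib]
      refine Finset.sum_congr rfl fun i _ => ?_
      rw [hc, hc, d.leibniz]; ring }

variable (d : Deriv A)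

@[simp]
lemma coeff_coeffDeriv (q : A[X]) (n : ℕ) : (coeffDeriv d q).coeff n = d (q.coeff n) := by
  change (∑ i ∈ Finset.range (q.natDegree + 1), monomial i (d (q.coeff i))).coeff n = _
  simp only [finsetSum_coeff, coeff_monomial, Finset.sum_ite_eq', Finset.mem_range]
  split_ifs with h
  · rfl
  · rw [coeff_eq_zero_of_natDegree_lt (by omega), map_zero]

@[simp]
lemma coeffDeriv_X : coeffDeriv d X = 0 := by
  ext n; simp [coeff_X, apply_ite d]

@[simp]
lemma coeffDeriv_C (a : A) : coeffDeriv d (C a) = C (d a) := by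
  ext n; simp [coeff_C, apply_ite d]

/-- The usual derivative of polynomials, as a `Deriv`. -/
noncomputable def polyDeriv (A : Type*) [CommRing A] : Deriv A[X] where
  __ := (derivative : A[X] →ₗ[A] A[X]).toAddMonoidHom
  leibniz' a b := by simp [derivative_mul]; ring

@[simp]
lemma polyDeriv_apply (q : A[X]) : polyDeriv A q = derivative q := rfl

/-- The derivation of `A[X]` acting as `d` on coefficients and sending `X` to `v`. -/
noncomputable def extendDeriv (v : A[X]) : Deriv A[X] where
  toFun q := coeffDeriv d q + v * derivative q
  map_zero' := by simp
  map_add' p q := by simp only [map_add]; ring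
  leibniz' p q := by rw [Deriv.leibniz, derivative_mul]; ring

lemma extendDeriv_apply (v q : A[X]) :
    extendDeriv d v q = coeffDeriv d q + v * derivative q := rfl

@[simp]
lemma extendDeriv_C (v : A[X]) (a : A) : extendDeriv d v (C a) = C (d a) := by
  simp [extendDeriv_apply]

end CoeffDeriv

section OneVariable
variable {k : Type*} [Field k]

/-- The first order operator `2 (1 - X²) q' + (c X - l) q` on polynomials. -/
noncomputable def weightOp (c l : k) (q : k[X]) : k[X] :=
  2 * (1 - X ^ 2) * derivative q + (C c * X - C l) * q

/-- The polynomial `(X - 1)^a (X + 1)^b`. -/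
noncomputable def basePoly (k : Type*) [Field k] (a b : ℕ) : k[X] := (X - 1) ^ a * (X + 1) ^ b

lemma basePoly_ne_zero (a b : ℕ) : basePoly k a b ≠ 0 := by
  refine mul_ne_zero (pow_ne_zero _ ?_) (pow_ne_zero _ ?_)
  · simpa using X_sub_C_ne_zero (1 : k)
  · simpa using X_add_C_ne_zero (1 : k)

lemma sq_mul_derivative_basePoly (a b : ℕ) :
    (X ^ 2 - 1) * derivative (basePoly k a b)
      = (C ((a : k) - b) + C ((a : k) + b) * X) * basePoly k a b := by
  have h1 : (X - 1 : k[X]) * derivative ((X - 1 : k[X]) ^ a) = (a : k[X]) * (X - 1) ^ a := by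
    cases a with
    | zero => simp
    | succ a => simp [derivative_pow]; ring
  have h2 : (X + 1 : k[X]) * derivative ((X + 1 : k[X]) ^ b) = (b : k[X]) * (X + 1) ^ b := by
    cases b with
    | zero => simp
    | succ a => simp [derivative_pow]; ring
  simp only [basePoly, derivative_mul, map_sub, map_add, map_natCast]
  linear_combination (X + 1) * (X + 1) ^ b * h1 + (X - 1) * (X - 1) ^ a * h2

lemma weightOp_basePoly_mul (c l : k) (a b : ℕ) (q : k[X]) :
    weightOp c l (basePoly k a b * q)
      = basePoly k a b * weightOp (c - 2 * (a + b)) (l + 2 * (a - b)) q := by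
  have h := sq_mul_derivative_basePoly (k := k) a b
  simp only [weightOp, derivative_mul, map_sub, map_add, map_mul, map_natCast, map_ofNat] at h ⊢
  linear_combination (-2 * q) * h

lemma weightOp_sq_sub_one_mul (c l : k) (q : k[X]) :
    weightOp (c + 4) l ((X ^ 2 - 1) * q) = (X ^ 2 - 1) * weightOp c l q := by
  have h := weightOp_basePoly_mul (c + 4) l 1 1 q
  have e : basePoly k 1 1 = X ^ 2 - 1 := by simp [basePoly]; ring
  rw [e] at h
  rw [h]; congr 2 <;> push_cast <;> ring

lemma weightOp_smul (c l r : k) (q : k[X]) : weightOp c l (C r * q) = C r * weightOp c l q := by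
  simp only [weightOp, derivative_mul, derivative_C]; ring

lemma eval_one_weightOp (c l : k) (q : k[X]) : (weightOp c l q).eval 1 = (c - l) * q.eval 1 := by
  simp [weightOp]

lemma eval_neg_one_weightOp (c l : k) (q : k[X]) :
    (weightOp c l q).eval (-1) = (-c - l) * q.eval (-1) := by
  simp [weightOp]

lemma exists_eq_pow_sub_one_mul {q : k[X]} (hq : q ≠ 0) :
    ∃ (a : ℕ) (r : k[X]), q = basePoly k a 0 * r ∧ r.eval 1 ≠ 0 := by
  obtain ⟨r, h1, h2⟩ := exists_eq_pow_rootMultiplicity_mul_and_not_dvd q hq 1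
  refine ⟨_, r, by simpa [basePoly] using h1, fun h => h2 (dvd_iff_isRoot.2 h)⟩

lemma exists_eq_pow_add_one_mul {q : k[X]} (hq : q ≠ 0) :
    ∃ (b : ℕ) (r : k[X]), q = basePoly k 0 b * r ∧ r.eval (-1) ≠ 0 := by
  obtain ⟨r, h1, h2⟩ := exists_eq_pow_rootMultiplicity_mul_and_not_dvd q hq (-1)
  refine ⟨_, r, by simpa [basePoly] using h1, fun h => h2 (dvd_iff_isRoot.2 h)⟩

lemma basePoly_mul (a b : ℕ) : basePoly k a 0 * basePoly k 0 b = basePoly k a b := by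
  simp [basePoly]

variable [CharZero k]

lemma kernel_weightOp {c l : k} {q : k[X]} (hq : q ≠ 0) (h : weightOp c l q = 0) :
    ∃ (a b : ℕ) (r : k), r ≠ 0 ∧ c = 2 * (a + b) ∧ l = 2 * (b - a) ∧ q = C r * basePoly k a b := by
  obtain ⟨a, q1, rfl, h1⟩ := exists_eq_pow_sub_one_mul hq
  obtain ⟨b, r, rfl, h2⟩ := exists_eq_pow_add_one_mul (right_ne_zero_of_mul hq)
  rw [← mul_assoc, basePoly_mul] at h hq ⊢
  have hr : r.eval 1 ≠ 0 := by
    intro h0; apply h1; simp [h0]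
  rw [weightOp_basePoly_mul] at h
  have h := (mul_eq_zero.1 h).resolve_left (basePoly_ne_zero a b)
  have e1 := congrArg (eval 1) h
  have e2 := congrArg (eval (-1)) h
  rw [eval_one_weightOp, eval_zero] at e1
  rw [eval_neg_one_weightOp, eval_zero] at e2
  have e1 := (mul_eq_zero.1 e1).resolve_right hr
  have e2 := (mul_eq_zero.1 e2).resolve_right h2
  have hc : c - 2 * (a + b) = 0 := by linear_combination (e1 - e2) / 2
  have hl : l + 2 * (a - b) = 0 := by linear_combination (-e1 - e2) / 2
  rw [hc, hl] at h
  have hd : derivative r = 0 := by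
    have hX : (2 * (1 - X ^ 2) : k[X]) ≠ 0 := by
      intro h0; have := congrArg (eval 0) h0; simp at this
    simpa [weightOp, hX] using h
  have hrC := eq_C_of_derivative_eq_zero hd
  refine ⟨a, b, r.coeff 0, ?_, by linear_combination hc, by linear_combination hl, ?_⟩
  · intro h0; rw [h0] at hrC; apply hr; rw [hrC]; simp
  · rw [mul_comm]; congr 1

lemma exists_eq_basePoly_mul {a b : ℕ} {j : ℤ} (hj : ¬ (4 : ℤ) ∣ j) {q h : k[X]}
    (hq : weightOp (2 * (a + b) + j : k) (2 * (b - a)) q = basePoly k a b * h) :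
    ∃ r, q = basePoly k a b * r ∧ weightOp (j : k) 0 r = h := by
  suffices hs : ∃ r, q = basePoly k a b * r by
    obtain ⟨r, rfl⟩ := hs
    refine ⟨r, rfl, ?_⟩
    rw [weightOp_basePoly_mul] at hq
    have := mul_left_cancel₀ (basePoly_ne_zero a b) hq
    rw [← this]; congr 1 <;> ring
  by_cases h0 : q = 0
  · exact ⟨0, by simp [h0]⟩
  have d1 : (X - 1 : k[X]) ^ a ∣ q := by
    obtain ⟨i, r, rfl, h1⟩ := exists_eq_pow_sub_one_mul h0
    by_cases hi : a ≤ i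
    · refine Dvd.dvd.mul_right ?_ _
      simpa [basePoly] using pow_dvd_pow _ hi
    exfalso
    push Not at hi
    obtain ⟨s, rfl⟩ := Nat.exists_eq_add_of_lt hi
    rw [weightOp_basePoly_mul] at hq
    have e : basePoly k (i + s + 1) b * h
        = basePoly k i 0 * ((X - 1) ^ (s + 1) * (X + 1) ^ b * h) := by
      simp [basePoly]; ring
    rw [e] at hq
    have := congrArg (eval 1) (mul_left_cancel₀ (basePoly_ne_zero i 0) hq)
    rw [eval_one_weightOp] at this
    simp [h1] at this
    apply hj
    refine ⟨-(s + 1), ?_⟩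
    have h4 : ((j + 4 * (s + 1) : ℤ) : k) = 0 := by push_cast; linear_combination this
    have := Int.cast_eq_zero.1 h4
    linarith
  have d2 : (X + 1 : k[X]) ^ b ∣ q := by
    obtain ⟨i, r, rfl, h1⟩ := exists_eq_pow_add_one_mul h0
    by_cases hi : b ≤ i
    · refine Dvd.dvd.mul_right ?_ _
      simpa [basePoly] using pow_dvd_pow _ hi
    exfalso
    push Not at hi
    obtain ⟨s, rfl⟩ := Nat.exists_eq_add_of_lt hi
    rw [weightOp_basePoly_mul] at hq
    have e : basePoly k a (i + s + 1) * h
        = basePoly k 0 i * ((X + 1) ^ (s + 1) * (X - 1) ^ a * h) := by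
      simp [basePoly]; ring
    rw [e] at hq
    have := congrArg (eval (-1)) (mul_left_cancel₀ (basePoly_ne_zero 0 i) hq)
    rw [eval_neg_one_weightOp] at this
    simp [h1] at this
    apply hj
    refine ⟨-(s + 1), ?_⟩
    have h4 : ((j + 4 * (s + 1) : ℤ) : k) = 0 := by push_cast; linear_combination -this
    have := Int.cast_eq_zero.1 h4
    linarith
  have hco : IsCoprime ((X - 1 : k[X]) ^ a) ((X + 1) ^ b) := by
    apply IsCoprime.pow
    refine ⟨-C (1 / 2), C (1 / 2), ?_⟩
    have : C (1 / 2 : k) * 2 = 1 := by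
      rw [← C_ofNat, ← C_mul]; norm_num
    linear_combination this
  exact hco.mul_dvd d1 d2

lemma coeff_weightOp_succ (c : k) (q : k[X]) (n : ℕ) :
    (weightOp c 0 q).coeff (n + 1) = (c - 2 * n) * q.coeff n + 2 * (n + 2) * q.coeff (n + 2) := by
  have : weightOp c 0 q = C 2 * derivative q - C 2 * (X * (X * derivative q)) + C c * (X * q) := by
    simp only [weightOp, C_ofNat, map_zero]; ring
  rw [this]
  cases n with
  | zero => simp [coeff_derivative]; ring
  | succ n => simp [coeff_derivative]; ring

lemma natDegree_add_one_le_of_weightOp {c : k} {q : k[X]} (hq : q ≠ 0)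
    (hc : c ≠ 2 * q.natDegree) : q.natDegree + 1 ≤ (weightOp c 0 q).natDegree := by
  apply le_natDegree_of_ne_zero
  rw [coeff_weightOp_succ, coeff_eq_zero_of_natDegree_lt (by omega : q.natDegree < q.natDegree + 2)]
  simp only [mul_zero, add_zero]
  exact mul_ne_zero (sub_ne_zero.2 hc) (leadingCoeff_ne_zero.2 hq)

lemma eq_zero_of_weightOp_eq_C {j : ℤ} (hj : Odd j) {q : k[X]} {r : k}
    (h : weightOp (j : k) 0 q = C r) : q = 0 ∧ r = 0 := by
  have : q = 0 := by
    by_contra hq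
    have := natDegree_add_one_le_of_weightOp (c := (j : k)) hq (by
      intro h; have h : j = 2 * q.natDegree := by exact_mod_cast h
      exact (Int.not_even_iff_odd.2 hj) (by rw [h]; exact even_two_mul _))
    rw [h] at this; simp at this
  subst this
  refine ⟨rfl, ?_⟩
  simpa [weightOp] using h.symm

lemma const_eq_zero_of_weightOp_eq_linear {j : ℤ} (hj : Odd j) {q : k[X]} {c0 c1 : k}
    (h : weightOp (j : k) 0 q = C c0 + C c1 * X) : c0 = 0 := by
  have hd : q.natDegree = 0 := by
    by_contra hq0
    have hq : q ≠ 0 := by rintro rfl; simp at hq0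
    have := natDegree_add_one_le_of_weightOp (c := (j : k)) hq (by
      intro h; have h : j = 2 * q.natDegree := by exact_mod_cast h
      exact (Int.not_even_iff_odd.2 hj) (by rw [h]; exact even_two_mul _))
    rw [h] at this
    have h2 : (C c0 + C c1 * X).natDegree ≤ 1 := by compute_degree
    omega
  rw [eq_C_of_natDegree_eq_zero hd] at h
  have := congrArg (eval 0) h
  simpa [weightOp] using this.symm

lemma eq_linear_of_weightOp_two {q : k[X]} {c0 c1 : k}
    (h : weightOp (2 : k) 0 q = C c0 + C c1 * X) : q = C (c1 / 2) + C (c0 / 2) * X := by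
  have hd : q.natDegree ≤ 1 := by
    by_contra hq0
    have hq : q ≠ 0 := by rintro rfl; simp at hq0
    have := natDegree_add_one_le_of_weightOp (c := (2 : k)) hq (by
      intro h; have h : 2 = 2 * q.natDegree := by exact_mod_cast h
      omega)
    rw [h] at this
    have h2 : (C c0 + C c1 * X).natDegree ≤ 1 := by compute_degree
    omega
  obtain ⟨r1, r0, rfl⟩ := exists_eq_X_add_C_of_natDegree_le_one hd
  have e0 := congrArg (coeff · 0) h
  have e1 := congrArg (coeff · (0 + 1)) h
  simp only [coeff_weightOp_succ] at e1
  simp [coeff_X, coeff_C] at e1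
  simp [weightOp] at e0
  rw [← e0, ← e1]
  simp; ring
end OneVariable

section Recurrence
variable {k : Type*} [Field k]

/-- One graded piece of the action of the Painlevé derivation, shifted by a multiple of the
identity, on a Laurent series with coefficients `p`. -/
noncomputable def drift (δ : Deriv k) (t α l u : k) (p : ℤ → k[X]) (m : ℤ) : k[X] :=
  weightOp ((m - 1 : ℤ) : k) l (p (m - 1)) + (coeffDeriv δ (p m) - C u * p m)
    + C t * derivative (p (m + 1)) + C α * derivative (p (m + 2))

/-- The recurrence satisfied by the coefficients of a homogenised Darboux polynomial. -/
structure IsDarbouxSystem (δ : Deriv k) (t α l u : k) (N : ℕ) (p : ℤ → ℤ → k[X]) :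
    Prop where
  recurrence : ∀ m i : ℤ,
    2 * (X ^ 2 - 1) * drift δ t α l u (p · i) (m - 4) - C t * drift δ t α l u (p · i) (m - 2)
      - C α * drift δ t α l u (p · i) (m - 1)
      - C ((N - i + 1 : ℤ) : k) * X * p (m - 3) (i - 1)
      - C ((N - i : ℤ) : k) * X * (C (2 * t) * p (m - 3) i + C (3 * α) * p (m - 2) i)
      + C (i : k) * p (m - 2) i
      + C ((i + 1 : ℤ) : k) * (2 * (X ^ 2 - 1) * p (m - 4) (i + 1) + C t * p (m - 2) (i + 1)
        + C (2 * α) * p (m - 1) (i + 1)) = 0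
  eq_zero_of_neg : ∀ n i : ℤ, i < 0 → p n i = 0
  eq_zero_of_lt : ∀ n i : ℤ, N < i → p n i = 0

variable {δ : Deriv k} {t α l u : k} {N : ℕ} {p : ℤ → ℤ → k[X]}

lemma weightOp_zero (c l : k) : weightOp c l 0 = 0 := by simp [weightOp]

lemma two_mul_X_sq_sub_one_ne_zero [CharZero k] : (2 * (X ^ 2 - 1) : k[X]) ≠ 0 := by
  intro h0; have := congrArg (eval 0) h0; simp at this

lemma coeffDeriv_basePoly (a b : ℕ) : coeffDeriv δ (basePoly k a b) = 0 := by
  have h : ∀ (c : k) (n : ℕ), δ c = 0 → coeffDeriv δ ((X - C c) ^ n) = 0 := by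
    intro c n hc
    rw [Deriv.leibniz_pow, map_sub, coeffDeriv_C, coeffDeriv_X, hc]
    simp
  have h1 := h 1 a (by simp)
  have h2 := h (-1) b (by simp)
  simp only [map_one, map_neg, sub_neg_eq_add] at h1 h2
  rw [basePoly, Deriv.leibniz, h1, h2]; simp

lemma coeffDeriv_C_mul_basePoly (c : k) (a b : ℕ) :
    coeffDeriv δ (C c * basePoly k a b) = C (δ c) * basePoly k a b := by
  rw [Deriv.leibniz, coeffDeriv_basePoly, coeffDeriv_C]; simp [mul_comm]

/-- An extremal index of a nonzero finitely supported family. -/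
lemma exists_max_index {M : Type*} [Zero M] {f : ℤ → M} {B : ℤ} (hB : ∀ i, B < i → f i = 0)
    {i₀ : ℤ} (h0 : f i₀ ≠ 0) : ∃ j, f j ≠ 0 ∧ ∀ i, j < i → f i = 0 := by
  obtain ⟨j, hj, hmax⟩ := Int.exists_greatest_of_bdd (P := fun i => f i ≠ 0)
    ⟨B, fun i hi => by by_contra h; exact hi (hB i (not_le.1 h))⟩ ⟨i₀, h0⟩
  exact ⟨j, hj, fun i hi => by by_contra h; exact absurd (hmax i h) (not_le.2 hi)⟩

variable [CharZero k]

theorem IsDarbouxSystem.weighted_pass (h : IsDarbouxSystem δ t α 0 u N p) {w i₀ : ℤ}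
    (hw : ∀ n i : ℤ, w < n - i → p n i = 0) (hi₀ : p (w + i₀) i₀ ≠ 0) :
    ∃ (a : ℕ) (c : k), c ≠ 0 ∧ w = 4 * a ∧ p w 0 = C c * basePoly k a a ∧
      ∀ i, i ≠ 0 → p (w + i) i = 0 := by
  have e2 := two_mul_X_sq_sub_one_ne_zero (k := k)
  have key : ∀ i : ℤ, weightOp ((w + i : ℤ) : k) 0 (p (w + i) i)
      + C ((i + 1 : ℤ) : k) * p (w + i + 1) (i + 1) = 0 := by
    intro i
    have := h.recurrence (w + i + 5) i
    simp only [drift] at this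
    simp (disch := omega) only [hw, weightOp_zero, map_zero, mul_zero, add_zero, sub_zero] at this
    rw [show w + i + 5 - 4 - 1 = w + i by ring, show w + i + 5 - 4 = w + i + 1 by ring] at this
    exact (mul_eq_zero.1 (by linear_combination this)).resolve_left e2
  obtain ⟨j, hj, hmax⟩ := exists_max_index (f := fun i => p (w + i) i) (B := N)
    (fun i hi => h.eq_zero_of_lt _ _ hi) hi₀
  have kj := key j
  have : p (w + (j + 1)) (j + 1) = 0 := hmax (j + 1) (by omega)
  have hj : p (w + j) j ≠ 0 := hj
  rw [show w + j + 1 = w + (j + 1) by ring, this, mul_zero, add_zero] at kj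
  obtain ⟨a, b, c, hc, hwj, hl, hp⟩ := kernel_weightOp hj kj
  have hab : a = b := by
    have : (b : k) = a := by linear_combination -hl / 2
    exact_mod_cast this.symm
  subst hab
  have hwj : w + j = 4 * a := by
    have : ((w + j : ℤ) : k) = ((4 * a : ℤ) : k) := by rw [hwj]; push_cast; ring
    exact_mod_cast this
  have hj0 : 0 ≤ j := by
    by_contra h'; exact hj (h.eq_zero_of_neg _ _ (not_le.1 h'))
  have hj1 : j = 0 := by
    by_contra hj1
    have kj := key (j - 1)
    have e : weightOp (2 * ((a : k) + a) + ((-1 : ℤ) : k)) (2 * ((a : k) - a))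
        (p (w + (j - 1)) (j - 1)) = basePoly k a a * C (-(j * c)) := by
      rw [show w + (j - 1) + 1 = w + j by ring, show j - 1 + 1 = j by ring, hp] at kj
      have e' : 2 * ((a : k) + a) + ((-1 : ℤ) : k) = ((w + (j - 1) : ℤ) : k) := by
        rw [show w + (j - 1) = 4 * a - 1 by omega]; push_cast; ring
      rw [e', sub_self, mul_zero, map_neg, map_mul]
      simp only [map_intCast] at kj ⊢
      linear_combination kj
    obtain ⟨r, -, hr⟩ := exists_eq_basePoly_mul (by norm_num) e
    have := (eq_zero_of_weightOp_eq_C (by decide) hr).2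
    simp [hc] at this
    exact hj1 this
  subst hj1
  refine ⟨a, c, hc, by omega, by simpa using hp, fun i hi => ?_⟩
  rcases lt_or_gt_of_ne hi with h' | h'
  · exact h.eq_zero_of_neg _ _ h'
  · exact hmax i h'

theorem IsDarbouxSystem.equal_pass (h : IsDarbouxSystem δ t α l u N p) (ht : δ t = 1)
    (hα : ∀ q : ℚ, α ≠ q) {w i₀ : ℤ}
    (hw : ∀ n i : ℤ, w < n → p n i = 0) (hi₀ : p w i₀ ≠ 0) :
    ∃ (a : ℕ) (j : ℤ) (φ : ℤ → k), 0 ≤ j ∧ l = 0 ∧ w = 4 * a ∧ 4 * (a : ℤ) = 3 * N - 2 * j ∧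
      ∀ i, p w i = C (φ i) * basePoly k a a := by
  have e2 := two_mul_X_sq_sub_one_ne_zero (k := k)
  have key1 : ∀ i, weightOp (w : k) l (p w i) = 0 := by
    intro i
    have := h.recurrence (w + 5) i
    simp only [drift] at this
    simp (disch := omega) only [hw, weightOp_zero, map_zero, mul_zero, add_zero, sub_zero] at this
    rw [show w + 5 - 4 - 1 = w by ring] at this
    exact (mul_eq_zero.1 (by linear_combination this)).resolve_left e2
  obtain ⟨a, b, c₀, hc₀, hwk, hl, hp₀⟩ := kernel_weightOp hi₀ (key1 i₀)
  have hwab : w = 2 * (a + b) := by exact_mod_cast hwk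
  have hφ : ∀ i, ∃ r, p w i = C r * basePoly k a b := by
    intro i
    by_cases h0 : p w i = 0
    · exact ⟨0, by simp [h0]⟩
    obtain ⟨a', b', c, hc, h1, h2, h3⟩ := kernel_weightOp h0 (key1 i)
    have ea : (a : k) = a' := by linear_combination (h1 - hwk - h2 + hl) / 4
    have eb : (b : k) = b' := by linear_combination (h1 - hwk + h2 - hl) / 4
    have ea : a = a' := by exact_mod_cast ea
    have eb : b = b' := by exact_mod_cast eb
    subst ea eb
    exact ⟨c, h3⟩
  choose φ hφ using hφ
  have hφ0 : ∀ i, p w i = 0 → φ i = 0 := by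
    intro i hi
    rw [hφ i] at hi
    simpa [basePoly_ne_zero] using hi
  -- the next coefficient vanishes
  have key2 : ∀ i, p (w - 1) i = 0 ∧ δ (φ i) - u * φ i + (i + 1) * φ (i + 1) = 0 := by
    intro i
    have := h.recurrence (w + 4) i
    simp only [drift] at this
    simp (disch := omega) only [hw, weightOp_zero, map_zero, mul_zero, add_zero, sub_zero] at this
    rw [show w + 4 - 4 = w by ring, hφ i, hφ (i + 1), coeffDeriv_C_mul_basePoly] at this
    have e : weightOp (2 * ((a : k) + b) + ((-1 : ℤ) : k)) (2 * ((b : k) - a))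
        (p (w - 1) i) = basePoly k a b * C (-(δ (φ i) - u * φ i + (i + 1) * φ (i + 1))) := by
      rw [← hl, show 2 * ((a : k) + b) + ((-1 : ℤ) : k) = ((w - 1 : ℤ) : k) by
        push_cast; linear_combination -hwk]
      refine mul_left_cancel₀ e2 ?_
      simp only [map_neg, map_add, map_mul, map_sub, map_intCast, map_one, Int.cast_add,
        Int.cast_one] at this ⊢
      linear_combination this
    obtain ⟨r, h1, hr⟩ := exists_eq_basePoly_mul (by norm_num) e
    have := eq_zero_of_weightOp_eq_C (by decide) hr
    refine ⟨by rw [h1, this.1, mul_zero], by linear_combination -this.2⟩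
  have hp1 : ∀ i, p (w - 1) i = 0 := fun i => (key2 i).1
  have hπ := sq_mul_derivative_basePoly (k := k) a b
  obtain ⟨ρ, hρ⟩ : ∃ ρ : ℤ → k, ∀ i, ρ i = 4⁻¹ * ((N - i + 1) * φ (i - 1) + 2 * t * (N - i) * φ i)
      - 2⁻¹ * (t * (a + b) * φ i) := ⟨_, fun i => rfl⟩
  have key3 : ∀ i, (X ^ 2 - 1) * p (w - 2) i
      = basePoly k a b * (C (ρ i) + C (-(t * (a - b) * φ i) / 2) * X) := by
    intro i
    have := h.recurrence (w + 3) i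
    simp only [drift] at this
    simp (disch := omega) only [hw, weightOp_zero, map_zero, mul_zero, add_zero, sub_zero] at this
    rw [show w + 3 - 4 = w - 1 by ring, show w + 3 - 3 = w by ring,
      show w + 3 - 2 - 1 = w by ring, show w - 1 - 1 = w - 2 by ring,
      show w - 1 + 1 = w by ring, hp1, hp1, key1, hφ i, hφ (i - 1)] at this
    have e : weightOp (2 * ((a : k) + b) + ((2 : ℤ) : k)) (2 * ((b : k) - a))
        ((X ^ 2 - 1) * p (w - 2) i) =
          basePoly k a b * (C (-(t * (a - b) * φ i)) + C (2 * ρ i) * X) := by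
      rw [← hl, show 2 * ((a : k) + b) + ((2 : ℤ) : k) = ((w - 2 : ℤ) : k) + 4 by
        push_cast; linear_combination -hwk, weightOp_sq_sub_one_mul, hρ]
      have hC : (2 : k[X]) ≠ 0 := two_ne_zero
      refine mul_left_cancel₀ hC ?_
      have h2 : (C (2⁻¹ : k)) * 2 = 1 := by
        rw [← C_ofNat, ← C_mul]; norm_num
      have h4 : (C (4⁻¹ : k)) * 4 = 1 := by
        rw [← C_ofNat, ← C_mul]; norm_num
      simp only [map_neg, map_add, map_mul, map_sub, map_intCast, map_one, Int.cast_add,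
        Int.cast_one, map_zero, derivative_mul, derivative_C, map_natCast, Int.cast_sub,
        Int.cast_natCast, map_ofNat] at this hπ ⊢
      linear_combination this - 2 * C t * C (φ i) * hπ
        - X * basePoly k a b * ((N - i + 1) * C (φ (i - 1)) + 2 * C t * (N - i) * C (φ i)) * h4
        + 2 * X * basePoly k a b * C t * (a + b) * C (φ i) * h2
    obtain ⟨r, h1, hr⟩ := exists_eq_basePoly_mul (by norm_num) e
    have hr : weightOp (2 : k) 0 r = C (-(t * (a - b) * φ i)) + C (2 * ρ i) * X := by
      rw [← hr, Int.cast_ofNat]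
    rw [h1, eq_linear_of_weightOp_two hr, mul_div_cancel_left₀ _ two_ne_zero]
  have key4 : ∀ i, 2 * (δ (ρ i) - u * ρ i + (i + 1) * ρ (i + 1)) + 2 * α * (a - b) * φ i + i * φ i
      + 2 * t * (i + 1) * φ (i + 1) = 0 := by
    intro i
    have := h.recurrence (w + 2) i
    simp only [drift] at this
    simp (disch := omega) only [hw, map_zero, mul_zero, add_zero, sub_zero] at this
    rw [show w + 2 - 4 = w - 2 by ring, show w + 2 - 3 = w - 1 by ring,
      show w + 2 - 2 = w by ring, show w - 2 - 1 = w - 3 by ring,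
      show w - 2 + 1 = w - 1 by ring, show w - 2 + 2 = w by ring, show w + 2 - 1 - 1 = w by ring,
      key1, hp1, hp1,
      hφ i, hφ (i + 1), coeffDeriv_C_mul_basePoly, weightOp_zero] at this
    obtain ⟨τ, hτ⟩ : ∃ τ : ℤ → k, ∀ i, τ i = -(t * (a - b) * φ i) / 2 := ⟨_, fun i => rfl⟩
    simp only [← hτ] at key3
    have hd := congrArg (coeffDeriv δ) (key3 i)
    have he : coeffDeriv δ (X ^ 2 - 1 : k[X]) = 0 := by
      simp [Deriv.leibniz_pow]
    simp only [Deriv.leibniz, coeffDeriv_basePoly, he, map_add,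
      coeffDeriv_C, coeffDeriv_X, add_zero, mul_zero, zero_add] at hd
    have k2 := (key2 i).2
    have e : weightOp (2 * ((a : k) + b) + ((1 : ℤ) : k)) (2 * ((b : k) - a))
        (C 2 * ((X ^ 2 - 1) * p (w - 3) i)) = basePoly k a b *
          (C (-(2 * (δ (ρ i) - u * ρ i + (i + 1) * ρ (i + 1)) + 2 * α * (a - b) * φ i + i * φ i
            + 2 * t * (i + 1) * φ (i + 1)))
          + C (-(2 * (δ (τ i) - u * τ i + (i + 1) * τ (i + 1)) + 2 * α * (a + b) * φ i
            - 3 * α * (N - i) * φ i)) * X) := by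
      rw [← hl, show 2 * ((a : k) + b) + ((1 : ℤ) : k) = ((w - 3 : ℤ) : k) + 4 by
        push_cast; linear_combination -hwk, weightOp_smul, weightOp_sq_sub_one_mul]
      have k2 := congrArg C k2
      have k3 := key3 i
      have k3' := key3 (i + 1)
      simp only [map_neg, map_add, map_mul, map_sub, map_intCast, map_one, Int.cast_add,
        Int.cast_one, map_zero, derivative_mul, derivative_C, map_natCast, Int.cast_sub,
        Int.cast_natCast, map_ofNat] at this hπ k2 ⊢
      linear_combination this - 2 * hd - 2 * C α * C (φ i) * hπ + 2 * C u * k3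
        - 2 * (i + 1) * k3' + C t * basePoly k a b * k2
    obtain ⟨r, -, hr⟩ := exists_eq_basePoly_mul (by norm_num) e
    simpa only [neg_eq_zero] using const_eq_zero_of_weightOp_eq_linear (by decide) hr
  obtain ⟨j, hj, hmax⟩ := exists_max_index (f := φ) (B := N)
    (fun i hi => hφ0 _ (h.eq_zero_of_lt _ _ hi)) (i₀ := i₀) (by
      intro h0; apply hi₀; rw [hφ, h0]; simp)
  have hj0 : 0 ≤ j := by
    by_contra h'; exact hj (hφ0 _ (h.eq_zero_of_neg _ _ (not_le.1 h')))
  have hfin : (3 * N - 2 * j : k) = 2 * (a + b) - 4 * α * (a - b) := by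
    have k4 := key4 j
    have k2 := (key2 j).2
    have k2' := (key2 (j - 1)).2
    have hs := hmax (j + 1) (by omega)
    rw [hρ, hρ, hs] at k4
    rw [hs] at k2
    rw [show j - 1 + 1 = j by ring] at k2'
    rw [show j + 1 - 1 = j by ring] at k4
    push_cast at k4 k2'
    have hn4 : δ (4 : k) = 0 := by
      have := δ.map_natCast 4; rwa [Nat.cast_ofNat] at this
    have hn2 : δ (2 : k) = 0 := by
      have := δ.map_natCast 2; rwa [Nat.cast_ofNat] at this
    have hd4 : δ (4⁻¹ : k) = 0 := by simp [Deriv.map_inv, hn4]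
    have hd2 : δ (2⁻¹ : k) = 0 := by simp [Deriv.map_inv, hn2]
    simp only [Deriv.leibniz, map_add, map_sub, hd2, hd4, hn2, ht,
      Deriv.map_natCast, Deriv.map_intCast, Deriv.map_one] at k4
    refine mul_right_cancel₀ hj ?_
    linear_combination 2 * k4 - (N - j + 1) * k2' + (2 * t * (a + b) - 2 * t * (N - j)) * k2
  have hab : a = b := by
    by_contra hab
    have hab' : (4 * ((a : k) - b)) ≠ 0 :=
      mul_ne_zero (by norm_num) (sub_ne_zero.2 (by exact_mod_cast hab))
    apply hα ((2 * (a + b) - (3 * N - 2 * j)) / (4 * (a - b)))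
    push_cast
    rw [eq_div_iff hab']
    linear_combination hfin
  subst hab
  refine ⟨a, j, φ, hj0, by linear_combination hl, by omega, ?_, hφ⟩
  have : ((4 * a : ℤ) : k) = ((3 * N - 2 * j : ℤ) : k) := by
    push_cast; linear_combination -hfin
  exact_mod_cast this
end Recurrence

section Homogenization

/-- If `ξ'/ξ` satisfies a Riccati equation up to the factor `e`, then homogenising a Darboux
polynomial of the Riccati equation gives a Darboux element. -/
lemma derivation_homogenize {S : Type*} [CommRing S] (d : Deriv S) {x y e q r G : S}
    {N : ℕ} (hx : d x = e * y + r * x) (hy : d y = e * q * x + r * y) (m : ℕ → S)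
    (hm : m (N + 1) = 0) (h0 : d (m 0) = e * (G * m 0 - q * m 1))
    (h1 : ∀ i, d (m (i + 1)) =
      e * (G * m (i + 1) - (i + 2) * q * m (i + 2) - (N - i) * m i)) :
    d (∑ i ∈ Finset.range (N + 1), m i * x ^ (N - i) * y ^ i)
      = (e * G + N * r) * ∑ i ∈ Finset.range (N + 1), m i * x ^ (N - i) * y ^ i := by
  obtain ⟨a, ha⟩ : ∃ a : ℕ → S, ∀ i, a i = i * q * m i * x ^ (N + 1 - i) * y ^ (i - 1) :=
    ⟨_, fun _ => rfl⟩
  obtain ⟨b, hb0, hb⟩ : ∃ b : ℕ → S, b 0 = 0 ∧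
      ∀ i, b (i + 1) = (N - i) * m i * x ^ (N - i - 1) * y ^ (i + 1) :=
    ⟨fun i => i.casesOn 0 fun i => (N - i) * m i * x ^ (N - i - 1) * y ^ (i + 1), rfl, fun _ => rfl⟩
  have hxp : ∀ n : ℕ, d (x ^ n) = n * r * x ^ n + n * e * x ^ (n - 1) * y := by
    intro n
    rw [Deriv.leibniz_pow, hx]
    cases n with
    | zero => simp
    | succ n => simp; ring
  have hyp : ∀ n : ℕ, d (y ^ n) = n * r * y ^ n + n * e * q * x * y ^ (n - 1) := by
    intro n
    rw [Deriv.leibniz_pow, hy]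
    cases n with
    | zero => simp
    | succ n => simp; ring
  have key : ∀ i ∈ Finset.range (N + 1), d (m i * x ^ (N - i) * y ^ i)
      = (e * G + N * r) * (m i * x ^ (N - i) * y ^ i)
        + e * ((b (i + 1) - b i) - (a (i + 1) - a i)) := by
    intro i hi
    rw [Finset.mem_range] at hi
    obtain ⟨j, rfl⟩ := Nat.exists_eq_add_of_le (Nat.lt_succ_iff.1 hi)
    simp only [Deriv.leibniz, hxp, hyp, ha, hb]
    cases i with
    | zero =>
      simp only [h0, hb0]
      cases j <;> simp <;> ring
    | succ i =>
      simp only [h1, hb]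
      rw [show i + 1 + j - (i + 1) = j by omega, show i + 1 + j - i = j + 1 by omega,
        show i + 1 + j + 1 - (i + 1 + 1) = j by omega,
          show i + 1 + j + 1 - (i + 1) = j + 1 by omega]
      cases j <;> simp <;> ring
  rw [map_sum, Finset.sum_congr rfl key, Finset.sum_add_distrib, ← Finset.mul_sum,
    ← Finset.mul_sum, Finset.sum_sub_distrib, Finset.sum_range_sub, Finset.sum_range_sub, hb0, hb,
    ha, ha, hm]
  simp

end Homogenization

section IntCoeff
variable {A : Type*} [CommRing A]

/-- The coefficients of a polynomial, indexed by all integers. -/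
noncomputable def intCoeff (q : A[X]) (n : ℤ) : A := if 0 ≤ n then q.coeff n.toNat else 0

lemma intCoeff_natCast (q : A[X]) (n : ℕ) : intCoeff q n = q.coeff n := by simp [intCoeff]

lemma intCoeff_of_neg (q : A[X]) {n : ℤ} (hn : n < 0) : intCoeff q n = 0 := by
  simp [intCoeff, not_le.2 hn]

lemma intCoeff_of_lt (q : A[X]) {n : ℤ} (hn : q.natDegree < n) : intCoeff q n = 0 := by
  obtain ⟨m, rfl⟩ := Int.eq_ofNat_of_zero_le (by omega : 0 ≤ n)
  rw [intCoeff_natCast]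
  exact coeff_eq_zero_of_natDegree_lt (by omega)

@[simp] lemma intCoeff_zero (n : ℤ) : intCoeff (0 : A[X]) n = 0 := by simp [intCoeff]

lemma intCoeff_add (p q : A[X]) (n : ℤ) : intCoeff (p + q) n = intCoeff p n + intCoeff q n := by
  unfold intCoeff; split_ifs <;> simp

lemma intCoeff_sub (p q : A[X]) (n : ℤ) : intCoeff (p - q) n = intCoeff p n - intCoeff q n := by
  unfold intCoeff; split_ifs <;> simp

lemma intCoeff_C_mul (a : A) (q : A[X]) (n : ℤ) : intCoeff (C a * q) n = a * intCoeff q n := by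
  unfold intCoeff; split_ifs <;> simp

lemma intCoeff_X_mul (q : A[X]) (n : ℤ) : intCoeff (X * q) n = intCoeff q (n - 1) := by
  rcases lt_trichotomy n 0 with h | rfl | h
  · rw [intCoeff_of_neg _ h, intCoeff_of_neg _ (by omega)]
  · rw [intCoeff_of_neg q (by omega)]; simp [intCoeff]
  · obtain ⟨m, hm⟩ := Int.eq_ofNat_of_zero_le (by omega : 0 ≤ n - 1)
    obtain rfl : n = ((m + 1 : ℕ) : ℤ) := by push_cast; omega
    rw [hm, intCoeff_natCast, intCoeff_natCast, coeff_X_mul]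

lemma intCoeff_X_pow_mul (j : ℕ) (q : A[X]) (n : ℤ) :
    intCoeff (X ^ j * q) n = intCoeff q (n - j) := by
  induction j generalizing n with
  | zero => simp
  | succ j ih =>
    rw [pow_succ', mul_assoc, intCoeff_X_mul, ih]; congr 1; push_cast; ring

lemma intCoeff_derivative (q : A[X]) (n : ℤ) :
    intCoeff (derivative q) n = ((n + 1 : ℤ) : A) * intCoeff q (n + 1) := by
  rcases lt_trichotomy n (-1) with h | rfl | h
  · rw [intCoeff_of_neg _ (by omega), intCoeff_of_neg _ (by omega), mul_zero]
  · rw [intCoeff_of_neg _ (by omega)]; simp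
  · obtain ⟨m, rfl⟩ := Int.eq_ofNat_of_zero_le (by omega : 0 ≤ n)
    have := intCoeff_natCast q (m + 1)
    push_cast at this
    rw [intCoeff_natCast, this, coeff_derivative]; push_cast; ring

lemma intCoeff_coeffDeriv (d : Deriv A) (q : A[X]) (n : ℤ) :
    intCoeff (coeffDeriv d q) n = d (intCoeff q n) := by
  unfold intCoeff; split_ifs <;> simp

end IntCoeff

section Blowup
variable {k : Type*} [Field k] (δ : Deriv k) (t α : k)

/-- The lift of `2 X³ + t X + α` to `k[g][X]`. -/
noncomputable def painleveCubic : k[X][X] := C 2 * X ^ 3 + C (C t) * X + C (C α)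

/-- The Painlevé derivation multiplied by `X²`, written on `k[g][X]` in the coordinates `X` and
`g = Y / X²`. -/
noncomputable def blowupDeriv : Deriv k[X][X] where
  toFun q := X ^ 2 * coeffDeriv (coeffDeriv δ) q
    + (C (2 * (1 - X ^ 2)) * X ^ 3 + C (C t) * X + C (C α)) * coeffDeriv (polyDeriv k) q
    + C X * X ^ 4 * derivative q
  map_zero' := by simp
  map_add' p q := by simp only [map_add]; ring
  leibniz' p q := by simp only [Deriv.leibniz, derivative_mul]; ring

lemma blowupDeriv_apply (q : k[X][X]) : blowupDeriv δ t α q =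
    X ^ 2 * coeffDeriv (coeffDeriv δ) q
    + (C (2 * (1 - X ^ 2)) * X ^ 3 + C (C t) * X + C (C α)) * coeffDeriv (polyDeriv k) q
    + C X * X ^ 4 * derivative q := rfl

lemma blowupDeriv_X : blowupDeriv δ t α X = C X * X ^ 4 := by
  simp [blowupDeriv_apply]

lemma blowupDeriv_C_X : blowupDeriv δ t α (C X) =
    C (2 * (1 - X ^ 2)) * X ^ 3 + C (C t) * X + C (C α) := by
  simp [blowupDeriv_apply]

lemma blowupDeriv_C_C (c : k) : blowupDeriv δ t α (C (C c)) = X ^ 2 * C (C (δ c)) := by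
  simp [blowupDeriv_apply]

/-- The cubic `(2 Y² - X f) / X` in the coordinates of `blowupDeriv`. -/
noncomputable def discr : k[X][X] := C (2 * (X ^ 2 - 1)) * X ^ 3 - C (C t) * X - C (C α)

/-- The first component of `V • (Y, f) + (X, 2 Y)`, where `V` is the outer variable and `(Y, f)` the
Painlevé vector field. -/
noncomputable def hamX : k[X][X][X] := X * C (C X * X ^ 2) + C X

/-- The second component of `V • (Y, f) + (X, 2 Y)`. -/
noncomputable def hamY : k[X][X][X] := X * C (painleveCubic t α) + C (2 * C X * X ^ 2)

/-- The derivation of `k[g][X][V]`, extending a multiple of `blowupDeriv`, for which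
`hamY / hamX` satisfies the Riccati equation of the linearised Painlevé equation up to scaling. -/
noncomputable def liftDeriv : Deriv k[X][X][X] where
  toFun q := C (discr t α) * coeffDeriv (blowupDeriv δ t α) q
    + (C (C X * X ^ 4) * X ^ 2 + C (X ^ 3 + C X * X ^ 3 * (2 * C (C t) * X + 3 * C (C α))) * X
      + C (X ^ 2 * (C (2 * (X ^ 2 - 1)) * X ^ 3 + C (C t) * X + 2 * C (C α)))) * derivative q
  map_zero' := by simp
  map_add' p q := by simp only [map_add]; ring
  leibniz' p q := by simp only [Deriv.leibniz, derivative_mul]; ring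

lemma liftDeriv_apply (q : k[X][X][X]) : liftDeriv δ t α q =
    C (discr t α) * coeffDeriv (blowupDeriv δ t α) q
    + (C (C X * X ^ 4) * X ^ 2 + C (X ^ 3 + C X * X ^ 3 * (2 * C (C t) * X + 3 * C (C α))) * X
      + C (X ^ 2 * (C (2 * (X ^ 2 - 1)) * X ^ 3 + C (C t) * X + 2 * C (C α)))) * derivative q := rfl

lemma liftDeriv_hamX : liftDeriv δ t α (hamX : k[X][X][X]) = C (X ^ 2 * discr t α) * hamY t α
    + (C (C X * X ^ 4) * X + C (C X * X ^ 3 * (2 * C (C t) * X + 3 * C (C α)))) * hamX := by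
  rw [liftDeriv_apply]
  simp only [hamX, hamY, map_add, coeffDeriv_C, Deriv.leibniz, coeffDeriv_X, blowupDeriv_X,
    blowupDeriv_C_X, derivative_mul, derivative_X, derivative_C, discr, painleveCubic,
    Deriv.leibniz_pow, map_mul, map_sub, map_pow, map_one, map_ofNat, mul_zero, add_zero]
  simp [derivative_pow]
  ring

variable {δ t α} in
lemma liftDeriv_hamY (ht : δ t = 1) (hα : δ α = 0) :
    liftDeriv δ t α (hamY t α) = C (X ^ 2 * discr t α) * C (6 * X ^ 2 + C (C t)) * hamX
    + (C (C X * X ^ 4) * X + C (C X * X ^ 3 * (2 * C (C t) * X + 3 * C (C α)))) * hamY t α := by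
  rw [liftDeriv_apply]
  simp only [hamX, hamY, map_add, coeffDeriv_C, Deriv.leibniz, coeffDeriv_X, blowupDeriv_X,
    blowupDeriv_C_X, blowupDeriv_C_C, derivative_mul, derivative_X, derivative_C, discr,
    painleveCubic, ht, hα,
    Deriv.leibniz_pow, map_mul, map_sub, map_pow, map_one, map_ofNat, mul_zero, add_zero]
  simp [derivative_pow]
  ring

end Blowup

section Blowup
variable {k : Type*} [Field k] {δ : Deriv k} {t α l u : k}

lemma intCoeff_discr_mul (q : k[X][X]) (m : ℤ) : intCoeff (discr t α * q) m =
    2 * (X ^ 2 - 1) * intCoeff q (m - 3) - C t * intCoeff q (m - 1) - C α * intCoeff q m := by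
  have : discr t α * q = C (2 * (X ^ 2 - 1)) * (X ^ 3 * q) - C (C t) * (X * q) - C (C α) * q := by
    rw [discr]; ring
  rw [this]
  simp only [intCoeff_sub, intCoeff_C_mul, intCoeff_X_mul, intCoeff_X_pow_mul]
  norm_num

lemma intCoeff_blowupDeriv_sub (q : k[X][X]) (m : ℤ) :
    intCoeff (blowupDeriv δ t α q - X ^ 2 * (C (C l) * X + C (C u)) * q) (m + 2) =
      drift δ t α l u (intCoeff q) m := by
  have : blowupDeriv δ t α q - X ^ 2 * (C (C l) * X + C (C u)) * q =
      X ^ 2 * coeffDeriv (coeffDeriv δ) q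
      + (C (2 * (1 - X ^ 2)) * (X ^ 3 * coeffDeriv (polyDeriv k) q)
        + C (C t) * (X * coeffDeriv (polyDeriv k) q) + C (C α) * coeffDeriv (polyDeriv k) q)
      + C X * (X ^ 4 * derivative q) - (C (C l) * (X ^ 3 * q) + C (C u) * (X ^ 2 * q)) := by
    rw [blowupDeriv_apply]; ring
  rw [this, drift, weightOp]
  simp only [intCoeff_sub, intCoeff_add, intCoeff_C_mul, intCoeff_X_mul, intCoeff_X_pow_mul,
    intCoeff_coeffDeriv, intCoeff_derivative, polyDeriv_apply]
  have e2 : m + 2 - (2 : ℕ) = m := by push_cast; ring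
  have e3 : m + 2 - (3 : ℕ) = m - 1 := by push_cast; ring
  have e4 : m + 2 - (4 : ℕ) + 1 = m - 1 := by push_cast; ring
  have e1 : m + 2 - 1 = m + 1 := by ring
  have ec : (C ((m - 1 : ℤ) : k) : k[X]) = ((m - 1 : ℤ) : k[X]) := map_intCast C _
  rw [e2, e3, e4, e1, ec]
  ring

lemma isDarbouxSystem_of_liftDeriv {N : ℕ} {F : k[X][X][X]} (hF : F.natDegree ≤ N)
    (h : liftDeriv δ t α F = (C (X ^ 2 * discr t α) * C (C (C l) * X + C (C u)) +
      (N : k[X][X][X]) * (C (C X * X ^ 4) * X +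
        C (C X * X ^ 3 * (2 * C (C t) * X + 3 * C (C α))))) * F) :
    IsDarbouxSystem δ t α l u N fun n i => intCoeff (intCoeff F i) n where
  eq_zero_of_neg n i hi := by
    rw [intCoeff_of_neg F hi, intCoeff_zero]
  eq_zero_of_lt n i hi := by
    rw [intCoeff_of_lt F (by omega), intCoeff_zero]
  recurrence m i := by
    have h1 : C (discr t α) * coeffDeriv (blowupDeriv δ t α) F
        + (C (C X * X ^ 4) * (X * (X * derivative F))
          + C (X ^ 3 + C X * X ^ 3 * (2 * C (C t) * X + 3 * C (C α))) * (X * derivative F)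
          + C (X ^ 2 * (C (2 * (X ^ 2 - 1)) * X ^ 3 + C (C t) * X + 2 * C (C α))) * derivative F)
        - (C (X ^ 2 * discr t α * (C (C l) * X + C (C u))) * F
          + C ((N : k[X][X]) * (C X * X ^ 4)) * (X * F)
          + C ((N : k[X][X]) * (C X * X ^ 3 * (2 * C (C t) * X + 3 * C (C α)))) * F) = 0 := by
      rw [liftDeriv_apply] at h
      have h := sub_eq_zero.2 h
      rw [← h]
      simp only [map_mul, map_natCast]
      ring
    have h2 := congrArg (intCoeff · i) h1
    simp only [intCoeff_add, intCoeff_sub, intCoeff_C_mul, intCoeff_X_mul, intCoeff_derivative,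
      intCoeff_coeffDeriv, intCoeff_zero] at h2
    rw [show i - 1 - 1 + 1 = i - 1 by ring, show i - 1 + 1 = i by ring] at h2
    generalize intCoeff F i = a at h2 ⊢
    generalize intCoeff F (i - 1) = b at h2 ⊢
    generalize intCoeff F (i + 1) = c at h2 ⊢
    have h3 : discr t α * (blowupDeriv δ t α a - X ^ 2 * (C (C l) * X + C (C u)) * a)
        + (C (-(C ((N - i + 1 : ℤ) : k) * X)) * (X ^ 4 * b)
          + C (-(C ((N - i : ℤ) : k) * X * C (2 * t))) * (X ^ 4 * a)
          + C (-(C ((N - i : ℤ) : k) * X * C (3 * α))) * (X ^ 3 * a)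
          + C (C (i : k)) * (X ^ 3 * a)
          + C (C ((i + 1 : ℤ) : k) * (2 * (X ^ 2 - 1))) * (X ^ 5 * c)
          + C (C ((i + 1 : ℤ) : k) * C t) * (X ^ 3 * c)
          + C (C ((i + 1 : ℤ) : k) * C (2 * α)) * (X ^ 2 * c)) = 0 := by
      rw [← h2]
      simp only [map_add, map_sub, map_neg, map_mul, map_pow, map_ofNat, map_one, map_intCast,
        map_natCast, Int.cast_sub, Int.cast_add, Int.cast_natCast, Int.cast_one]
      ring
    have h4 := congrArg (intCoeff · (m + 1)) h3
    simp only [intCoeff_add, intCoeff_C_mul, intCoeff_X_pow_mul, intCoeff_zero,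
      intCoeff_discr_mul] at h4
    rw [show m + 1 - 3 = m - 4 + 2 by ring, show m + 1 - 1 = m - 2 + 2 by ring,
      show m + 1 = m - 1 + 2 by ring] at h4
    simp only [intCoeff_blowupDeriv_sub] at h4
    have e2 : m - 1 + 2 - (2 : ℕ) = m - 1 := by push_cast; ring
    have e3 : m - 1 + 2 - (3 : ℕ) = m - 2 := by push_cast; ring
    have e4 : m - 1 + 2 - (4 : ℕ) = m - 3 := by push_cast; ring
    have e5 : m - 1 + 2 - (5 : ℕ) = m - 4 := by push_cast; ring
    rw [e2, e3, e4, e5] at h4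
    rw [← h4]
    ring

end Blowup

section Blowup
variable {k : Type*} [Field k]

/-- Clearing denominators in the value of a polynomial at `-1 / b`. -/
lemma pow_mul_eval_neg_one_div {A : Type*} [Field A] {N : ℕ} {F : A[X]} (hF : F.natDegree ≤ N)
    {b : A} (hb : b ≠ 0) :
    b ^ N * F.eval (-1 / b) = ∑ i ∈ Finset.range (N + 1), F.coeff i * (-1) ^ i * b ^ (N - i) := by
  rw [eval_eq_sum_range' (Nat.lt_succ_iff.2 hF), Finset.mul_sum]
  refine Finset.sum_congr rfl fun i hi => ?_
  obtain ⟨j, rfl⟩ := Nat.exists_eq_add_of_le (Nat.lt_succ_iff.1 (Finset.mem_range.1 hi))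
  rw [div_pow, Nat.add_sub_cancel_left, pow_add]
  field_simp

lemma sum_coeff_homogenize {A : Type*} [CommRing A] [IsDomain A] {N : ℕ} (n : ℕ → A)
    {a b c e : A} (hb : b ≠ 0) {F : A[X]}
    (hF : F = ∑ i ∈ Finset.range (N + 1), C (n i) * (X * C (a * b) + C a) ^ (N - i) *
      (X * C c + C e) ^ i) (hdeg : F.natDegree ≤ N) :
    ∑ i ∈ Finset.range (N + 1), F.coeff i * (-1) ^ i * b ^ (N - i) = n N * (b * e - c) ^ N := by
  have hb' : algebraMap A (FractionRing A) b ≠ 0 := by simpa using hb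
  apply IsFractionRing.injective A (FractionRing A)
  set f := algebraMap A (FractionRing A)
  have h1 := pow_mul_eval_neg_one_div (F := F.map f) (natDegree_map_le.trans hdeg) hb'
  have h2 : (F.map f).eval (-1 / f b) = f (n N) * (-1 / f b * f c + f e) ^ N := by
    rw [hF, Polynomial.map_sum, eval_finsetSum, Finset.sum_range_succ, Finset.sum_eq_zero]
    · simp only [Polynomial.map_mul, Polynomial.map_pow, Polynomial.map_add, map_C, map_X, eval_mul,
        eval_pow, eval_add, eval_C, eval_X, Nat.sub_self, pow_zero, mul_one,
        zero_add]
    · intro i hi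
      have h0 : N - i ≠ 0 := by have := Finset.mem_range.1 hi; omega
      have : -1 / f b * (f a * f b) + f a = 0 := by field_simp; ring
      simp [this, h0]
  rw [h2] at h1
  simp only [coeff_map] at h1
  simp only [map_sum, map_mul, map_pow, map_neg, map_one, map_sub, ← h1]
  rw [mul_left_comm, ← mul_pow]
  congr 2
  field_simp
  ring

lemma natDegree_X_mul_C_add_C_le {A : Type*} [CommRing A] (a b : A) :
    (X * C a + C b).natDegree ≤ 1 := by
  rw [mul_comm]; exact natDegree_linear_le

variable [CharZero k] {δ : Deriv k} {t α l u : k}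

lemma leadingCoeff_discr : (discr t α).leadingCoeff = 2 * (X ^ 2 - 1) := by
  have : discr t α = C (2 * (X ^ 2 - 1)) * X ^ 3 + C 0 * X ^ 2 + C (-C t) * X + C (-C α) := by
    rw [discr]; simp; ring
  rw [this, leadingCoeff_cubic two_mul_X_sq_sub_one_ne_zero]

lemma le_of_mul_pow_eq {N a : ℕ} {c : k} {q : k[X]} (hc : c ≠ 0)
    (h : (2 * (X ^ 2 - 1)) ^ N * q = X ^ N * (C c * basePoly k a a)) : N ≤ a := by
  by_contra! hlt
  obtain ⟨j, rfl⟩ := Nat.exists_eq_add_of_lt hlt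
  have h1 : basePoly k a 0 * ((X - 1) ^ (j + 1) * (2 * (X + 1)) ^ (a + j + 1) * q)
      = basePoly k a 0 * (X ^ (a + j + 1) * (C c * (X + 1) ^ a)) := by
    simp only [basePoly] at h ⊢
    rw [show (2 * (X ^ 2 - 1) : k[X]) = (X - 1) * (2 * (X + 1)) by ring, mul_pow] at h
    linear_combination h
  have h2 := congrArg (eval 1) (mul_left_cancel₀ (basePoly_ne_zero a 0) h1)
  simp [hc, one_add_one_eq_two] at h2

/-- A polynomial in the blown-up coordinates which is a Darboux polynomial of the Riccati
extension is constant. -/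
theorem eq_const_of_riccati_darboux (ht : δ t = 1) (hα0 : δ α = 0) (hα : ∀ q : ℚ, α ≠ q)
    (N : ℕ) (n : ℕ → k[X][X]) (hzero : n (N + 1) = 0) (hN : n N ≠ 0)
    (h0 : blowupDeriv δ t α (n 0) = X ^ 2 * ((C (C l) * X + C (C u)) * n 0
      - (6 * X ^ 2 + C (C t)) * n 1))
    (h1 : ∀ i : ℕ, blowupDeriv δ t α (n (i + 1)) = X ^ 2 * ((C (C l) * X + C (C u)) * n (i + 1)
      - ((i : k[X][X]) + 2) * (6 * X ^ 2 + C (C t)) * n (i + 2)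
      - ((N : k[X][X]) - (i : k[X][X])) * n i)) :
    N = 0 ∧ ∃ c, n 0 = C (C c) := by
  obtain ⟨F, hF⟩ : ∃ F : k[X][X][X], F = ∑ i ∈ Finset.range (N + 1),
    C (n i) * hamX ^ (N - i) * hamY t α ^ i := ⟨_, rfl⟩
  have hdeg : F.natDegree ≤ N := by
    rw [hF]
    refine natDegree_sum_le_of_forall_le _ _ fun i hi => ?_
    have hi' := Nat.lt_succ_iff.1 (Finset.mem_range.1 hi)
    have hx : (hamX (k := k)).natDegree ≤ 1 := natDegree_X_mul_C_add_C_le _ _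
    have hy : (hamY t α).natDegree ≤ 1 := natDegree_X_mul_C_add_C_le _ _
    have hx' := natDegree_pow_le_of_le (N - i) hx
    have hy' := natDegree_pow_le_of_le i hy
    have := natDegree_mul_le_of_le (natDegree_mul_le_of_le (natDegree_C (n i)).le hx') hy'
    omega
  have hsys : IsDarbouxSystem δ t α l u N fun n i => intCoeff (intCoeff F i) n := by
    apply isDarbouxSystem_of_liftDeriv hdeg
    rw [hF]
    refine derivation_homogenize _ (liftDeriv_hamX _ _ _)
      (q := C (6 * X ^ 2 + C (C t))) (liftDeriv_hamY ht hα0) (fun i => C (n i)) ?_ ?_ ?_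
    · simp [hzero]
    · rw [liftDeriv_apply]
      simp only [coeffDeriv_C, h0, derivative_C, mul_zero, add_zero, map_mul, map_sub, map_add]
      ring
    · intro i
      rw [liftDeriv_apply]
      simp only [coeffDeriv_C, h1, derivative_C, mul_zero, add_zero, map_mul, map_sub, map_add,
        map_natCast, map_ofNat]
      ring
  have hstar : ∑ i ∈ Finset.range (N + 1), F.coeff i * (-1) ^ i * (C X * X) ^ (N - i)
      = n N * discr t α ^ N := by
    have e1 : discr t α = C X * X * (2 * C X * X ^ 2) - painleveCubic t α := by
      rw [discr, painleveCubic]; simp only [map_mul, map_sub, map_pow, map_ofNat, map_one]; ring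
    rw [e1]
    refine sum_coeff_homogenize n (a := X) ?_ ?_ hdeg
    · simp
    · rw [hF, hamX, hamY, show (C X * X ^ 2 : k[X][X]) = X * (C X * X) by ring]
  have hFne : F ≠ 0 := by
    rintro rfl
    have hd : discr t α ≠ 0 := by
      rw [← leadingCoeff_ne_zero, leadingCoeff_discr]; exact two_mul_X_sq_sub_one_ne_zero
    refine mul_ne_zero hN (pow_ne_zero N hd) ?_
    rw [← hstar]; simp
  obtain ⟨B, hB⟩ : ∃ B : ℕ, ∀ n i : ℤ, (B : ℤ) < n → intCoeff (intCoeff F i) n = 0 := by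
    refine ⟨∑ i ∈ Finset.range (N + 1), (F.coeff i).natDegree, fun n i hn => ?_⟩
    rcases lt_or_ge i 0 with hi | hi
    · exact hsys.eq_zero_of_neg n i hi
    rcases lt_or_ge (N : ℤ) i with hi' | hi'
    · exact hsys.eq_zero_of_lt n i hi'
    obtain ⟨j, rfl⟩ := Int.eq_ofNat_of_zero_le hi
    have hj := Finset.single_le_sum (f := fun i => (F.coeff i).natDegree) (fun _ _ => Nat.zero_le _)
      (Finset.mem_range.2 (by omega : j < N + 1))
    rw [intCoeff_natCast, intCoeff_of_lt]
    exact lt_of_le_of_lt (by exact_mod_cast hj) hn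
  obtain ⟨i₀, m₀, hm₀⟩ : ∃ i₀ m₀ : ℤ, intCoeff (intCoeff F i₀) m₀ ≠ 0 := by
    refine ⟨F.natDegree, F.leadingCoeff.natDegree, ?_⟩
    rw [intCoeff_natCast, intCoeff_natCast]
    simpa using hFne
  obtain ⟨w, hw, hwmax⟩ := exists_max_index (f := fun n i => intCoeff (intCoeff F i) n) (B := B)
    (fun n hn => funext fun i => hB n i hn) (i₀ := m₀) fun h => hm₀ (congrFun h i₀)
  obtain ⟨i₁, hi₁⟩ := Function.ne_iff.1 hw
  obtain ⟨a, j, φ, hj, rfl, hwa, haN, hφ⟩ := hsys.equal_pass ht hα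
    (fun n i hn => congrFun (hwmax n hn) i) hi₁
  obtain ⟨v, hv, hvmax⟩ := exists_max_index (f := fun d i => intCoeff (intCoeff F i) (d + i))
    (B := B) (fun n hn => funext fun i => by
      rcases lt_or_ge i 0 with hi | hi
      · exact hsys.eq_zero_of_neg _ i hi
      · exact hB _ _ (by omega)) (i₀ := m₀ - i₀) fun h => hm₀ (by simpa using congrFun h i₀)
  obtain ⟨i₂, hi₂⟩ := Function.ne_iff.1 hv
  obtain ⟨b, c, hc, hvb, hvc, hv0⟩ := hsys.weighted_pass
    (fun n i hn => by simpa using congrFun (hvmax (n - i) hn) i) hi₂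
  have hcne : C c * basePoly k b b ≠ 0 := mul_ne_zero (by simpa using hc) (basePoly_ne_zero b b)
  have hvw : v ≤ w := by
    by_contra! hlt
    exact hcne (hvc ▸ congrFun (hwmax v hlt) 0)
  have hterm : ∀ (m : ℤ) (i : ℕ), i ≤ N →
      intCoeff (F.coeff i * (-1) ^ i * (C X * X) ^ (N - i)) (m + N)
        = (-1) ^ i * X ^ (N - i) * intCoeff (intCoeff F i) (m + i) := by
    intro m i hi
    have : F.coeff i * (-1) ^ i * (C X * X) ^ (N - i)
        = C ((-1) ^ i * X ^ (N - i)) * (X ^ (N - i) * F.coeff i) := by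
      simp only [map_mul, map_pow, map_neg, map_one, mul_pow]; ring
    rw [this, intCoeff_C_mul, intCoeff_X_pow_mul, intCoeff_natCast]
    congr 2
    omega
  have hcoef : ∀ m : ℤ, intCoeff (n N * discr t α ^ N) (m + N)
      = ∑ i ∈ Finset.range (N + 1), (-1) ^ i * X ^ (N - i) * intCoeff (intCoeff F i) (m + i) := by
    intro m
    rw [← hstar, ← Finset.sum_congr rfl fun i hi =>
      hterm m i (Nat.lt_succ_iff.1 (Finset.mem_range.1 hi))]
    generalize Finset.range (N + 1) = s
    induction s using Finset.cons_induction with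
    | empty => simp
    | cons a s ha ih => rw [Finset.sum_cons, intCoeff_add, ih, Finset.sum_cons]
  have htop : intCoeff (n N * discr t α ^ N) (v + N) = X ^ N * (C c * basePoly k b b) := by
    rw [hcoef, Finset.sum_range_succ', Finset.sum_eq_zero]
    · simp [hvc]
    · intro i _
      have := hv0 (i + 1) (by omega)
      push_cast
      rw [this, mul_zero]
  have hhigh : ∀ m, v < m → intCoeff (n N * discr t α ^ N) (m + N) = 0 := by
    intro m hm
    rw [hcoef]
    refine Finset.sum_eq_zero fun i _ => ?_
    have := congrFun (hvmax m hm) i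
    simp only [Pi.zero_apply] at this
    rw [this, mul_zero]
  have hlead : (n N * discr t α ^ N).leadingCoeff = X ^ N * (C c * basePoly k b b) := by
    have hnd : (n N * discr t α ^ N).natDegree = 4 * b + N := by
      apply natDegree_eq_of_le_of_coeff_ne_zero
      · rw [natDegree_le_iff_coeff_eq_zero]
        intro m hm
        rw [← intCoeff_natCast, show (m : ℤ) = (m - N) + N by ring]
        exact hhigh _ (by omega)
      · rw [← intCoeff_natCast, Nat.cast_add, Nat.cast_mul, Nat.cast_ofNat, ← hvb, htop]
        exact mul_ne_zero (by simp) hcne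
    rw [leadingCoeff, hnd, ← htop, hvb, ← intCoeff_natCast]
    push_cast
    rfl
  rw [leadingCoeff_mul, leadingCoeff_pow, leadingCoeff_discr, mul_comm] at hlead
  have hNb := le_of_mul_pow_eq hc hlead
  have hN0 : N = 0 := by omega
  subst hN0
  have ha0 : a = 0 := by omega
  subst ha0
  refine ⟨rfl, φ 0, ?_⟩
  have hF0 : intCoeff F 0 = n 0 := by rw [hF]; simp [intCoeff]
  ext1 m
  rw [← intCoeff_natCast, ← hF0]
  rcases Nat.eq_zero_or_pos m with rfl | hm
  · have := hφ 0
    rw [hwa] at this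
    simpa [basePoly] using this
  · rw [coeff_C_of_ne_zero hm.ne']
    exact congrFun (hwmax m (by omega)) 0

end Blowup

section Riccati
variable {k : Type*} [Field k] (δ : Deriv k) (t α : k)

/-- The derivation of `k[X][Y]` with `X ↦ Y` and `Y ↦ 2 X³ + t X + α`. -/
noncomputable def painleveDeriv : Deriv k[X][X] where
  toFun q := coeffDeriv (coeffDeriv δ) q + X * coeffDeriv (polyDeriv k) q
    + C (C 2 * X ^ 3 + C t * X + C α) * derivative q
  map_zero' := by simp
  map_add' p q := by simp only [map_add]; ring
  leibniz' p q := by simp only [Deriv.leibniz, derivative_mul]; ring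

lemma painleveDeriv_apply (q : k[X][X]) : painleveDeriv δ t α q =
    coeffDeriv (coeffDeriv δ) q + X * coeffDeriv (polyDeriv k) q
    + C (C 2 * X ^ 3 + C t * X + C α) * derivative q := rfl

/-- The derivation of `k[X][Y][U]` extending `painleveDeriv` with `U ↦ 6 X² + t - U²`. -/
noncomputable def riccatiDeriv : Deriv k[X][X][X] :=
  extendDeriv (painleveDeriv δ t α) (C (C (6 * X ^ 2 + C t)) - X ^ 2)

/-- The substitution `X ↦ X`, `Y ↦ g X²` from `k[X][Y]` to `k[g][X]`. -/
noncomputable def blowup : k[X][X] →+* k[X][X] := eval₂RingHom (mapRingHom C) (C X * X ^ 2)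

@[simp] lemma blowup_X : blowup (X : k[X][X]) = C X * X ^ 2 := by simp [blowup]

@[simp] lemma blowup_C (a : k[X]) : blowup (C a) = a.map C := by simp [blowup]

lemma coeff_coeff_blowup (q : k[X][X]) (n j : ℕ) : ((blowup q).coeff n).coeff j =
    if 2 * j ≤ n then (q.coeff j).coeff (n - 2 * j) else 0 := by
  induction q using Polynomial.induction_on' with
  | add p q hp hq => rw [map_add, coeff_add, coeff_add, hp, hq]; split_ifs <;> simp
  | monomial i a =>
    have : blowup (monomial i a) = C (X ^ i) * (a.map C * X ^ (2 * i)) := by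
      rw [← C_mul_X_pow_eq_monomial]; simp; ring
    rw [this, coeff_C_mul, coeff_mul_X_pow', coeff_monomial]
    by_cases h : i = j
    · subst h
      split_ifs <;> simp_all [coeff_X_pow]
    · split_ifs <;> simp_all [coeff_X_pow, eq_comm]

lemma blowup_injective : Function.Injective (blowup (k := k)) := by
  rw [injective_iff_map_eq_zero]
  intro q hq
  ext j m
  have := coeff_coeff_blowup q (m + 2 * j) j
  rw [hq] at this
  simpa using this.symm

lemma blowup_painleveDeriv (q : k[X][X]) :
    blowupDeriv δ t α (blowup q) = X ^ 2 * blowup (painleveDeriv δ t α q) := by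
  have hmul : ∀ p q : k[X][X],
      blowupDeriv δ t α (blowup p) = X ^ 2 * blowup (painleveDeriv δ t α p) →
      blowupDeriv δ t α (blowup q) = X ^ 2 * blowup (painleveDeriv δ t α q) →
      blowupDeriv δ t α (blowup (p * q)) = X ^ 2 * blowup (painleveDeriv δ t α (p * q)) := by
    intro p q hp hq
    simp only [map_mul, Deriv.leibniz, map_add, hp, hq]
    ring
  have hX : blowupDeriv δ t α (blowup X) = X ^ 2 * blowup (painleveDeriv δ t α X) := by
    rw [blowup_X, Deriv.leibniz, Deriv.leibniz_pow, blowupDeriv_X, blowupDeriv_C_X,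
      painleveDeriv_apply]
    simp only [coeffDeriv_X, mul_zero, zero_add, derivative_X, mul_one, blowup_C,
      Polynomial.map_add,
      Polynomial.map_mul, Polynomial.map_pow, map_C, map_X, map_mul, map_sub, map_one, map_ofNat,
      map_pow]
    norm_num
    ring
  have hCX : blowupDeriv δ t α (blowup (C X)) = X ^ 2 * blowup (painleveDeriv δ t α (C X)) := by
    rw [painleveDeriv_apply]
    simp [blowupDeriv_X]
    ring
  have hCC : ∀ c, blowupDeriv δ t α (blowup (C (C c)))
      = X ^ 2 * blowup (painleveDeriv δ t α (C (C c))) := by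
    intro c
    rw [painleveDeriv_apply]
    simp [blowupDeriv_C_C]
  have hC : ∀ a, blowupDeriv δ t α (blowup (C a)) = X ^ 2 * blowup (painleveDeriv δ t α (C a)) := by
    intro a
    induction a using Polynomial.induction_on with
    | C c => exact hCC c
    | add p q hp hq => simp only [map_add, hp, hq]; ring
    | monomial n c h =>
      rw [pow_succ, ← mul_assoc, C_mul]
      exact hmul _ _ h hCX
  induction q using Polynomial.induction_on with
  | C a => exact hC a
  | add p q hp hq => simp only [map_add, hp, hq]; ring
  | monomial n c h =>
    rw [pow_succ, ← mul_assoc]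
    exact hmul _ _ h hX

lemma natDegree_blowupDeriv_le (q : k[X][X]) :
    (blowupDeriv δ t α q).natDegree ≤ q.natDegree + 3 := by
  have hc : ∀ d : Deriv k[X], (coeffDeriv d q).natDegree ≤ q.natDegree := by
    intro d
    rw [natDegree_le_iff_coeff_eq_zero]
    intro n hn
    rw [coeff_coeffDeriv, coeff_eq_zero_of_natDegree_lt hn, map_zero]
  have h1 : (C (2 * (1 - X ^ 2)) * X ^ 3 + C (C t) * X + C (C α) : k[X][X]).natDegree ≤ 3 := by
    compute_degree
  rw [blowupDeriv_apply]
  refine natDegree_add_le_of_degree_le (natDegree_add_le_of_degree_le ?_ ?_) ?_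
  · have := natDegree_mul_le_of_le (natDegree_X_pow_le (R := k[X]) 2) (hc (coeffDeriv δ))
    omega
  · have := natDegree_mul_le_of_le h1 (hc (polyDeriv k))
    omega
  · rcases Nat.eq_zero_or_pos q.natDegree with h | h
    · rw [eq_C_of_natDegree_eq_zero h]; simp
    · have h4 : (C X * X ^ 4 : k[X][X]).natDegree ≤ 4 := natDegree_C_mul_X_pow_le _ _
      have := natDegree_mul_le_of_le h4 (natDegree_derivative_le q)
      omega

end Riccati

section Riccati
variable {k : Type*} [Field k]

lemma exists_linear_of_blowup {P : k[X][X]} (h : (blowup P).natDegree ≤ 1) :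
    ∃ l u, blowup P = C (C l) * X + C (C u) := by
  have hc : ∀ n, n ≤ 1 → ∃ c, (blowup P).coeff n = C c := by
    intro n hn
    refine ⟨((blowup P).coeff n).coeff 0, ?_⟩
    ext j
    cases j with
    | zero => simp
    | succ j => rw [coeff_coeff_blowup, if_neg (by omega)]; simp
  obtain ⟨l, hl⟩ := hc 1 le_rfl
  obtain ⟨u, hu⟩ := hc 0 (Nat.zero_le 1)
  exact ⟨l, u, by rw [← hl, ← hu]; exact eq_X_add_C_of_natDegree_le_one h⟩

variable {δ : Deriv k} {t α : k}

lemma natDegree_le_one_of_riccati_darboux {N : ℕ} {G : k[X][X]} {n : ℕ → k[X][X]}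
    (hzero : ∀ i, N < i → n i = 0) (hN : n N ≠ 0)
    (h0 : blowupDeriv δ t α (n 0) = X ^ 2 * (G * n 0 - (6 * X ^ 2 + C (C t)) * n 1))
    (h1 : ∀ i : ℕ, blowupDeriv δ t α (n (i + 1)) = X ^ 2 * (G * n (i + 1)
      - ((i : k[X][X]) + 2) * (6 * X ^ 2 + C (C t)) * n (i + 2)
      - ((N : k[X][X]) - (i : k[X][X])) * n i)) : G.natDegree ≤ 1 := by
  by_cases hG : G = 0
  · simp [hG]
  classical
  obtain ⟨i, hi, hmax⟩ := ((Finset.range (N + 1)).filter fun i => n i ≠ 0).exists_max_image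
    (fun i => (n i).natDegree + i) ⟨N, by simpa using hN⟩
  simp only [Finset.mem_filter, Finset.mem_range] at hi hmax
  have hle : ∀ j, n j ≠ 0 → (n j).natDegree + j ≤ (n i).natDegree + i := fun j hj =>
    hmax j ⟨by by_contra h; exact hj (hzero j (by omega)), hj⟩
  have hp : (6 * X ^ 2 + C (C t) : k[X][X]).natDegree ≤ 2 := by compute_degree
  have hnext : ∀ (c : k[X]), (C c * (6 * X ^ 2 + C (C t)) * n (i + 1)).natDegree
      ≤ (n i).natDegree + 1 := by
    intro c
    by_cases h : n (i + 1) = 0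
    · simp [h]
    have h1 := hle _ h
    have h2 := natDegree_mul_le_of_le (natDegree_mul_le_of_le (natDegree_C c).le hp)
      (le_refl (n (i + 1)).natDegree)
    omega
  suffices hs : (X ^ 2 * (G * n i)).natDegree ≤ (n i).natDegree + 3 by
    rw [natDegree_mul (by simp) (mul_ne_zero hG hi.2), natDegree_X_pow, natDegree_mul hG hi.2] at hs
    omega
  have hX : ∀ {q : k[X][X]} {m : ℕ}, q.natDegree ≤ m + 1 → (X ^ 2 * q).natDegree ≤ m + 3 := by
    intro q m h
    have := natDegree_mul_le_of_le (natDegree_X_pow_le (R := k[X]) 2) h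
    omega
  cases i with
  | zero =>
    have e : X ^ 2 * (G * n 0) = blowupDeriv δ t α (n 0)
        + X ^ 2 * (C 1 * (6 * X ^ 2 + C (C t)) * n (0 + 1)) := by
      rw [h0, C_1]; ring
    rw [e]
    exact natDegree_add_le_of_degree_le (natDegree_blowupDeriv_le _ _ _ _) (hX (hnext _))
  | succ i =>
    have e : X ^ 2 * (G * n (i + 1)) = blowupDeriv δ t α (n (i + 1))
        + X ^ 2 * (C ((i : k[X]) + 2) * (6 * X ^ 2 + C (C t)) * n (i + 1 + 1))
        + X ^ 2 * (C ((N : k[X]) - i) * n i) := by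
      rw [h1]; simp only [map_add, map_sub, map_natCast, map_ofNat]; ring
    rw [e]
    refine natDegree_add_le_of_degree_le (natDegree_add_le_of_degree_le
      (natDegree_blowupDeriv_le _ _ _ _) (hX (hnext _))) (hX ?_)
    refine natDegree_C_mul_le _ _ |>.trans ?_
    by_cases h : n i = 0
    · simp [h]
    have := hle _ h
    omega

variable [CharZero k]

/-- Darboux polynomials of the Riccati extension of generic Painlevé II are constant. -/
theorem eq_const_of_dvd_riccatiDeriv (ht : δ t = 1) (hα0 : δ α = 0) (hα : ∀ q : ℚ, α ≠ q)
    {M : k[X][X][X]} (hM : M ≠ 0) (h : M ∣ riccatiDeriv δ t α M) : ∃ c, M = C (C (C c)) := by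
  obtain ⟨Q, hQ⟩ := h
  obtain ⟨N, hN⟩ : ∃ N, M.natDegree = N := ⟨_, rfl⟩
  have hlc : M.coeff N ≠ 0 := by rw [← hN]; simpa using hM
  have hz : ∀ i, N < i → M.coeff i = 0 := fun i hi => coeff_eq_zero_of_natDegree_lt (by omega)
  have hD : riccatiDeriv δ t α M = coeffDeriv (painleveDeriv δ t α) M
      + C (C (6 * X ^ 2 + C t)) * derivative M - X * (X * derivative M) := by
    rw [riccatiDeriv, extendDeriv_apply]; ring
  have hdeg : (riccatiDeriv δ t α M).natDegree ≤ N + 1 := by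
    rw [natDegree_le_iff_coeff_eq_zero]
    intro n hn
    obtain ⟨m, rfl⟩ := Nat.exists_eq_add_of_le' (show 2 ≤ n by omega)
    rw [hD]
    simp only [coeff_sub, coeff_add, coeff_coeffDeriv, coeff_C_mul, coeff_X_mul, coeff_derivative]
    rw [hz _ (by omega), hz _ (by omega), hz (m + 1) (by omega)]
    simp
  have hQd : Q.natDegree ≤ 1 := by
    by_cases hQ0 : Q = 0
    · simp [hQ0]
    rw [hQ, natDegree_mul hM hQ0] at hdeg
    omega
  have hQe := eq_X_add_C_of_natDegree_le_one hQd
  generalize Q.coeff 1 = Q1 at hQe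
  generalize Q.coeff 0 = G at hQe
  have hMQ : M * Q = C Q1 * (X * M) + C G * M := by rw [hQe]; ring
  rw [hMQ, hD] at hQ
  have hQ1 : Q1 = -(N : k[X][X]) := by
    have := congrArg (coeff · (N + 1)) hQ
    simp only [coeff_sub, coeff_add, coeff_coeffDeriv, coeff_C_mul, coeff_X_mul] at this
    rw [hz _ (by omega)] at this
    cases N with
    | zero =>
      rw [coeff_derivative, hz _ (by omega), map_zero] at this
      simpa [hlc, hz] using this.symm
    | succ N =>
      rw [coeff_X_mul, coeff_derivative, coeff_derivative, hz _ (by omega)] at this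
      apply mul_right_cancel₀ hlc
      rw [map_zero] at this
      push_cast at this ⊢
      linear_combination -this
  have hm0 : painleveDeriv δ t α (M.coeff 0)
      = G * M.coeff 0 - C (6 * X ^ 2 + C t) * M.coeff 1 := by
    have := congrArg (coeff · 0) hQ
    simp only [coeff_sub, coeff_add, coeff_coeffDeriv, coeff_C_mul, coeff_derivative,
      coeff_X_mul_zero] at this
    simp at this ⊢
    linear_combination this
  have hm1 : ∀ i, painleveDeriv δ t α (M.coeff (i + 1)) = G * M.coeff (i + 1)
      - ((i : k[X][X]) + 2) * C (6 * X ^ 2 + C t) * M.coeff (i + 2)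
      - ((N : k[X][X]) - (i : k[X][X])) * M.coeff i := by
    intro i
    have := congrArg (coeff · (i + 1)) hQ
    simp only [coeff_sub, coeff_add, coeff_coeffDeriv, coeff_C_mul, coeff_derivative,
      coeff_X_mul, hQ1] at this
    have e : (X * derivative M).coeff i = (i : k[X][X]) * M.coeff i := by
      cases i with
      | zero => simp
      | succ i => rw [coeff_X_mul, coeff_derivative]; push_cast; ring
    rw [e] at this
    push_cast at this
    linear_combination this
  have hp : blowup (C (6 * X ^ 2 + C t)) = (6 * X ^ 2 + C (C t) : k[X][X]) := by
    simp
  have hb0 : blowupDeriv δ t α (blowup (M.coeff 0)) = X ^ 2 * (blowup G * blowup (M.coeff 0)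
      - (6 * X ^ 2 + C (C t)) * blowup (M.coeff 1)) := by
    rw [blowup_painleveDeriv, hm0, map_sub, map_mul, map_mul, hp]
  have hb1 : ∀ i : ℕ, blowupDeriv δ t α (blowup (M.coeff (i + 1))) =
      X ^ 2 * (blowup G * blowup (M.coeff (i + 1))
      - ((i : k[X][X]) + 2) * (6 * X ^ 2 + C (C t)) * blowup (M.coeff (i + 2))
      - ((N : k[X][X]) - (i : k[X][X])) * blowup (M.coeff i)) := by
    intro i
    rw [blowup_painleveDeriv, hm1, map_sub, map_sub, map_mul, map_mul, map_mul, map_mul, map_sub,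
      map_add, map_natCast, map_natCast, hp, map_ofNat]
  have hbz : ∀ i, N < i → blowup (M.coeff i) = 0 := fun i hi => by rw [hz i hi, map_zero]
  have hbN : blowup (M.coeff N) ≠ 0 := (map_ne_zero_iff _ blowup_injective).2 hlc
  obtain ⟨l, u, hlu⟩ := exists_linear_of_blowup
    (natDegree_le_one_of_riccati_darboux (n := fun i => blowup (M.coeff i)) hbz hbN hb0 hb1)
  rw [hlu] at hb0 hb1
  obtain ⟨rfl, c, hc⟩ := eq_const_of_riccati_darboux ht hα0 hα N (fun i => blowup (M.coeff i))
    (hbz _ (by omega)) hbN hb0 hb1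
  refine ⟨c, ?_⟩
  rw [eq_C_of_natDegree_eq_zero hN]
  congr 1
  apply blowup_injective
  simpa using hc
end Riccati

section Annihilator

/-- The annihilating polynomials of an algebraic element over a UFD form a principal ideal. -/
lemma exists_generator_annihilator {R E : Type*} [CommRing R] [IsDomain R]
    [UniqueFactorizationMonoid R] [Field E] (f : R →+* E) (hf : Function.Injective f) {v : E}
    {Q : R[X]} (hQ : Q ≠ 0) (hv : eval₂ f v Q = 0) :
    ∃ P : R[X], P ≠ 0 ∧ eval₂ f v P = 0 ∧ ∀ Q : R[X], eval₂ f v Q = 0 → P ∣ Q := by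
  classical
  let := f.toAlgebra
  let : NormalizationMonoid R :=
    UniqueFactorizationMonoid.strongNormalizationMonoid.toNormalizationMonoid
  let : NormalizedGCDMonoid R := UniqueFactorizationMonoid.toNormalizedGCDMonoid R
  let F := FractionRing R
  let : Algebra F E := (IsFractionRing.lift (K := F) (g := f) hf).toAlgebra
  have : IsScalarTower R F E := IsScalarTower.of_algebraMap_eq fun x => by
    change f x = IsFractionRing.lift hf _
    simp
  have key : ∀ Q : R[X], aeval v (Q.map (algebraMap R F)) = eval₂ f v Q := fun Q => by
    rw [aeval_map_algebraMap]; rfl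
  have hinj : Function.Injective (algebraMap R F) := IsFractionRing.injective R F
  have hint : IsIntegral F v := by
    refine IsAlgebraic.isIntegral ⟨Q.map (algebraMap R F), ?_, by rw [key, hv]⟩
    rwa [Ne, Polynomial.map_eq_zero_iff hinj]
  set m := minpoly F v with hm
  have hm0 : m ≠ 0 := minpoly.ne_zero hint
  obtain ⟨b, hbR, hb⟩ := IsLocalization.integerNormalization_spec (nonZeroDivisors R) m
  set q := IsLocalization.integerNormalization (nonZeroDivisors R) m with hq
  have hb0 : (algebraMap R F b) ≠ 0 := by
    rw [Ne, map_eq_zero_iff _ hinj]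
    exact nonZeroDivisors.ne_zero hbR
  have hbm : q.map (algebraMap R F) = C (algebraMap R F b) * m := by
    rw [hb, Algebra.smul_def]; rfl
  have hq0 : q ≠ 0 := by
    intro h
    rw [h, Polynomial.map_zero, eq_comm, mul_eq_zero] at hbm
    exact hbm.elim (fun h' => hb0 (C_eq_zero.1 h')) hm0
  have hcont : algebraMap R F q.content ≠ 0 := by
    rw [Ne, map_eq_zero_iff _ hinj, content_eq_zero_iff]; exact hq0
  have hprim : C (algebraMap R F q.content) * q.primPart.map (algebraMap R F)
      = C (algebraMap R F b) * m := by
    rw [← hbm]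
    conv_rhs => rw [q.eq_C_content_mul_primPart]
    simp
  refine ⟨q.primPart, q.primPart_ne_zero, ?_, fun Q hQ => ?_⟩
  · have := congrArg (aeval v) hprim
    rw [map_mul, map_mul, hm, minpoly.aeval, mul_zero, key, mul_eq_zero] at this
    refine this.resolve_left ?_
    simpa using hcont
  · refine q.isPrimitive_primPart.dvd_of_fraction_map_dvd_fraction_map (K := F) ?_
    have h1 : m ∣ Q.map (algebraMap R F) := minpoly.dvd _ _ (by rw [key, hQ])
    refine dvd_trans ?_ h1
    refine ⟨C (algebraMap R F b)⁻¹ * C (algebraMap R F q.content), ?_⟩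
    have h2 : C (algebraMap R F b)⁻¹ * C (algebraMap R F b) = (1 : F[X]) := by
      rw [← C_mul, inv_mul_cancel₀ hb0, C_1]
    linear_combination -m * h2 - C (algebraMap R F b)⁻¹ * hprim

/-- If `d` extends a derivation `d'` of `R[X]` along evaluation at `v`, then an element `v`
algebraic over `R` is a root of a nonzero polynomial `P` with `P ∣ d' P`. -/
lemma exists_darboux_of_algebraic {R E : Type*} [CommRing R] [IsDomain R]
    [UniqueFactorizationMonoid R] [Field E] (f : R →+* E) (hf : Function.Injective f) {v : E}
    (d : Deriv E) (d' : Deriv R[X]) (hd : ∀ Q, d (eval₂ f v Q) = eval₂ f v (d' Q))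
    {Q : R[X]} (hQ : Q ≠ 0) (hv : eval₂ f v Q = 0) :
    ∃ P : R[X], P ≠ 0 ∧ eval₂ f v P = 0 ∧ P ∣ d' P := by
  obtain ⟨P, hP, h0, h⟩ := exists_generator_annihilator f hf hQ hv
  exact ⟨P, hP, h0, h _ (by rw [← hd, h0, map_zero])⟩

end Annihilator

section Transcendence
variable {k E : Type*} [Field k] [Field E] (f : k →+* E) {δ : Deriv k} {d : Deriv E}

lemma deriv_eval₂ {R : Type*} [CommRing R] (f : R →+* E) {e : R → E} (he : ∀ c, d (f c) = e c)
    (v : E) (Q : R[X]) :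
    d (eval₂ f v Q) = Q.sum (fun i c => e c * v ^ i) + d v * eval₂ f v (derivative Q) := by
  have h0 : ∀ i, e 0 * v ^ i = 0 := fun i => by rw [← he]; simp
  induction Q using Polynomial.induction_on' with
  | add p q hp hq =>
    rw [eval₂_add, map_add, hp, hq, sum_add_index _ _ _ h0
      (fun i a b => by rw [← he, map_add, map_add, he, he]; ring), derivative_add, eval₂_add]
    ring
  | monomial i a =>
    rw [sum_monomial_index _ _ (h0 i), derivative_monomial, eval₂_monomial, eval₂_monomial,
      Deriv.leibniz, he, Deriv.leibniz_pow]
    simp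
    ring

lemma eval₂_coeffDeriv {R : Type*} [CommRing R] (f : R →+* E) (δ : Deriv R) (v : E) (Q : R[X]) :
    eval₂ f v (coeffDeriv δ Q) = Q.sum fun i c => f (δ c) * v ^ i := by
  induction Q using Polynomial.induction_on' with
  | add p q hp hq =>
    rw [sum_add_index _ _ _ (by simp) (fun i a b => by rw [map_add, map_add]; ring), ← hp, ← hq,
      map_add, eval₂_add]
  | monomial i a =>
    have : coeffDeriv δ (monomial i a) = monomial i (δ a) := by
      ext n; simp [coeff_monomial, apply_ite δ]
    rw [this, eval₂_monomial, sum_monomial_index _ _ (by simp)]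

lemma deriv_eval₂_coeffDeriv {R : Type*} [CommRing R] (f : R →+* E) {δ : Deriv R}
    (he : ∀ c, d (f c) = f (δ c)) (v : E) (Q : R[X]) :
    d (eval₂ f v Q) = eval₂ f v (coeffDeriv δ Q) + d v * eval₂ f v (derivative Q) := by
  rw [deriv_eval₂ f he, eval₂_coeffDeriv]

lemma deriv_eval_painleveDeriv (he : ∀ c, d (f c) = f (δ c)) {t α : k} {z : E}
    (hz : d (d z) = 2 * z ^ 3 + f t * z + f α) (Q : k[X][X]) :
    d (eval₂ (eval₂RingHom f z) (d z) Q) =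
      eval₂ (eval₂RingHom f z) (d z) (painleveDeriv δ t α Q) := by
  have h0 : ∀ p : k[X], d (eval₂RingHom f z p) = eval₂RingHom f z (coeffDeriv δ p)
      + d z * eval₂RingHom f z (polyDeriv k p) := fun p => deriv_eval₂_coeffDeriv f he z p
  have hsum : (Q.sum fun i c => (eval₂RingHom f z (coeffDeriv δ c)
      + d z * eval₂RingHom f z (polyDeriv k c)) * d z ^ i) =
      eval₂ (eval₂RingHom f z) (d z) (coeffDeriv (coeffDeriv δ) Q)
      + d z * eval₂ (eval₂RingHom f z) (d z) (coeffDeriv (polyDeriv k) Q) := by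
    rw [eval₂_coeffDeriv, eval₂_coeffDeriv, Polynomial.sum, Polynomial.sum, Polynomial.sum,
      Finset.mul_sum, ← Finset.sum_add_distrib]
    exact Finset.sum_congr rfl fun i _ => by ring
  rw [deriv_eval₂ _ h0, hsum, painleveDeriv_apply, hz, ← map_ofNat f 2]
  simp [eval₂_pow]

lemma deriv_eval_riccatiDeriv (he : ∀ c, d (f c) = f (δ c)) {t α : k} {z v : E}
    (hz : d (d z) = 2 * z ^ 3 + f t * z + f α) (hv : d v = 6 * z ^ 2 + f t - v ^ 2)
    (Q : k[X][X][X]) :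
    d (eval₂ (eval₂RingHom (eval₂RingHom f z) (d z)) v Q) =
      eval₂ (eval₂RingHom (eval₂RingHom f z) (d z)) v (riccatiDeriv δ t α Q) := by
  rw [deriv_eval₂_coeffDeriv (δ := painleveDeriv δ t α) _
    (fun c => deriv_eval_painleveDeriv f he hz c), riccatiDeriv, extendDeriv_apply, eval₂_add,
    eval₂_mul, hv]
  simp [eval₂_pow]

lemma eval_deriv_injective [CharZero k] (he : ∀ c, d (f c) = f (δ c)) {t α : k} (ht : δ t = 1)
    (hα0 : δ α = 0) (hα : ∀ q : ℚ, α ≠ q) {z : E}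
    (hz : d (d z) = 2 * z ^ 3 + f t * z + f α)
    (htr : Function.Injective (eval₂RingHom f z)) :
    Function.Injective (eval₂RingHom (eval₂RingHom f z) (d z)) := by
  rw [injective_iff_map_eq_zero]
  intro Q hQ
  by_contra hQ0
  obtain ⟨P, hP, hP0, hdvd⟩ := exists_darboux_of_algebraic _ htr d (painleveDeriv δ t α)
    (deriv_eval_painleveDeriv f he hz) hQ0 hQ
  have : (C P : k[X][X][X]) ∣ riccatiDeriv δ t α (C P) := by
    rw [riccatiDeriv, extendDeriv_C]
    exact _root_.map_dvd C hdvd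
  obtain ⟨c, hc⟩ := eq_const_of_dvd_riccatiDeriv ht hα0 hα (C_ne_zero.2 hP) this
  rw [C_inj] at hc
  subst hc
  simp at hP0
  simp [hP0] at hP

lemma eval_riccati_injective [CharZero k] (he : ∀ c, d (f c) = f (δ c)) {t α : k} (ht : δ t = 1)
    (hα0 : δ α = 0) (hα : ∀ q : ℚ, α ≠ q) {z v : E}
    (hz : d (d z) = 2 * z ^ 3 + f t * z + f α) (hv : d v = 6 * z ^ 2 + f t - v ^ 2)
    (htr : Function.Injective (eval₂RingHom f z)) :
    Function.Injective (eval₂RingHom (eval₂RingHom (eval₂RingHom f z) (d z)) v) := by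
  rw [injective_iff_map_eq_zero]
  intro Q hQ
  by_contra hQ0
  obtain ⟨P, hP, hP0, hdvd⟩ := exists_darboux_of_algebraic _
    (eval_deriv_injective f he ht hα0 hα hz htr) d (riccatiDeriv δ t α)
    (deriv_eval_riccatiDeriv f he hz hv) hQ0 hQ
  obtain ⟨c, rfl⟩ := eq_const_of_dvd_riccatiDeriv ht hα0 hα hP hdvd
  simp at hP0
  simp [hP0] at hP

end Transcendence

section Acl
variable (F : Type*) {E : Type*} [Field F] [Field E] [Algebra F E]
open IntermediateField

/-- The elements of `E` algebraic over the subfield generated by `F` and `S`. -/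
def acl (S : Set E) : Set E := {x | IsAlgebraic (adjoin F S) x}

variable {F}

lemma acl_eq_closure (S : Set E) : acl F S = (AlgebraicIndependent.matroid F E).closure S := by
  rw [AlgebraicIndependent.matroid_closure_eq]
  ext x
  change IsAlgebraic _ _ ↔ IsAlgebraic _ _
  rw [isAlgebraic_adjoin_iff]

lemma mem_acl_iff {S : Set E} {x : E} : x ∈ acl F S ↔ IsAlgebraic (Algebra.adjoin F S) x :=
  isAlgebraic_adjoin_iff

lemma adjoin_subset_acl (S : Set E) : (adjoin F S : Set E) ⊆ acl F S :=
  fun x hx => isAlgebraic_algebraMap (⟨x, hx⟩ : adjoin F S)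

lemma subset_acl (S : Set E) : S ⊆ acl F S := (subset_adjoin F S).trans (adjoin_subset_acl S)

lemma acl_mono {S T : Set E} (h : S ⊆ T) : acl F S ⊆ acl F T := by
  rw [acl_eq_closure, acl_eq_closure]
  exact Matroid.closure_subset_closure _ h

lemma acl_subset_acl {S T : Set E} (h : S ⊆ acl F T) : acl F S ⊆ acl F T := by
  rw [acl_eq_closure] at *
  rw [acl_eq_closure]
  exact Matroid.closure_subset_closure_of_subset_closure h

lemma mem_acl_insert_of_mem {S : Set E} {x y : E} (h : x ∈ acl F (insert y S))
    (hx : x ∉ acl F S) : y ∈ acl F (insert x S) := by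
  rw [acl_eq_closure] at *
  exact Matroid.mem_closure_insert hx h

/-- The field with underlying set `acl F S`. -/
def aclField (F : Type*) [Field F] [Algebra F E] (S : Set E) : Subfield E :=
  (algebraicClosure (adjoin F S) E).toSubfield

lemma mem_aclField {S : Set E} {x : E} : x ∈ aclField F S ↔ x ∈ acl F S := mem_algebraicClosure_iff

lemma acl_adjoin (S T : Set E) : acl (adjoin F S) T = acl F (S ∪ T) := by
  ext x
  change IsAlgebraic ((adjoin (adjoin F S) T).restrictScalars F) x ↔
    IsAlgebraic (adjoin F (S ∪ T)) x
  rw [adjoin_adjoin_left]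

lemma acl_union_range_subset {L : Type*} [Field L] [Algebra F L] [Algebra L E]
    [IsScalarTower F L E] (T : Set E) : acl F (Set.range (algebraMap L E) ∪ T) ⊆ acl L T := by
  have h : adjoin F ((adjoin L T).restrictScalars F : Set E) = (adjoin L T).restrictScalars F :=
    adjoin_self _ _
  have h2 : Set.range (algebraMap L E) ∪ T ⊆ ((adjoin L T).restrictScalars F : Set E) := by
    refine Set.union_subset ?_ (subset_adjoin _ _)
    rintro _ ⟨c, rfl⟩
    exact (adjoin L T).algebraMap_mem c
  intro x hx
  have h3 := acl_mono h2 hx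
  change IsAlgebraic _ _ at h3
  rw [h] at h3
  exact h3

lemma map_mem_acl_iff {L : Type*} [Field L] [Algebra F L] [Algebra L E]
    [IsScalarTower F L E] {S : Set L} {x : L} :
    algebraMap L E x ∈ acl F (algebraMap L E '' S) ↔ x ∈ acl F S := by
  let φ : L →ₐ[F] E := IsScalarTower.toAlgHom F L E
  have hφ : Function.Injective φ := (algebraMap L E).injective
  have he : (Algebra.adjoin F S).map φ = Algebra.adjoin F (algebraMap L E '' S) :=
    AlgHom.map_adjoin φ S
  let f : Algebra.adjoin F S →+* Algebra.adjoin F (algebraMap L E '' S) :=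
    ((φ.comp (Algebra.adjoin F S).val).codRestrict (Algebra.adjoin F (algebraMap L E '' S))
      fun a => he.le ⟨a, a.2, rfl⟩).toRingHom
  rw [mem_acl_iff, mem_acl_iff]
  refine ⟨fun h => h.of_ringHom_of_comp_eq f (algebraMap L E) (fun b => ?_) hφ rfl,
    fun h => h.ringHom_of_comp_eq f (algebraMap L E) (fun a b h => ?_) rfl⟩
  · obtain ⟨a, ha, hab⟩ := he.ge b.2
    exact ⟨⟨a, ha⟩, Subtype.ext hab⟩
  · exact Subtype.ext (hφ (congrArg Subtype.val h))

lemma algebraicIndepOn_insert_iff {ι : Type*} {f : ι → E} {s : Set ι} {i : ι} (h : i ∉ s) :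
    AlgebraicIndepOn F f (insert i s) ↔ AlgebraicIndepOn F f s ∧ f i ∉ acl F (f '' s) := by
  rw [AlgebraicIndepOn.insert_iff h, mem_acl_iff, Transcendental]

lemma algebraicIndependent_pair_iff {a b : E} :
    AlgebraicIndependent F ![a, b] ↔ a ∉ acl F ∅ ∧ b ∉ acl F {a} := by
  have h : (Set.univ : Set (Fin 2)) = insert 1 (insert 0 ∅) := by
    ext i; fin_cases i <;> simp
  rw [← AlgebraicIndepOn.univ, h, algebraicIndepOn_insert_iff (by simp),
    algebraicIndepOn_insert_iff (by simp), Set.image_insert_eq, Set.image_empty]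
  simpa [AlgebraicIndepOn, algebraicIndependent_empty_type_iff] using
    fun _ _ => (algebraMap F E).injective

section Deriv
variable {d : Deriv E} {C : Subfield E} {V : AddSubgroup E}

lemma deriv_mem_of_mem_adjoin (hV : ∀ c ∈ C, ∀ v ∈ V, c * v ∈ V) {S : Set E}
    (hC : (adjoin F S : Set E) ⊆ C) (hF : ∀ c, d (algebraMap F E c) ∈ V)
    (hS : ∀ s ∈ S, d s ∈ V) {x : E} (hx : x ∈ adjoin F S) : d x ∈ V := by
  induction hx using adjoin_induction with
  | mem x hx => exact hS x hx
  | algebraMap c => exact hF c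
  | add x y hx hy ihx ihy => rw [map_add]; exact V.add_mem ihx ihy
  | mul x y hx hy ihx ihy =>
    rw [Deriv.leibniz]
    exact V.add_mem (hV _ (hC hx) _ ihy) (hV _ (hC hy) _ ihx)
  | inv x hx ih =>
    rw [Deriv.map_inv, div_eq_inv_mul]
    exact V.neg_mem (hV _ (C.inv_mem (C.pow_mem (hC hx) 2)) _ ih)

lemma deriv_mem_of_mem_acl [CharZero E] (hV : ∀ c ∈ C, ∀ v ∈ V, c * v ∈ V) {S : Set E}
    (hC : acl F S ⊆ C) (hF : ∀ c, d (algebraMap F E c) ∈ V)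
    (hS : ∀ s ∈ S, d s ∈ V) {x : E} (hx : x ∈ acl F S) : d x ∈ V := by
  have hC' := (adjoin_subset_acl S).trans hC
  set A := adjoin F S
  have hA : ∀ a ∈ A, d a ∈ V := fun a ha => deriv_mem_of_mem_adjoin hV hC' hF hS ha
  have hint : IsIntegral A x := hx.isIntegral
  set p := minpoly A x
  have h0 := deriv_eval₂ (d := d) (algebraMap A E) (e := fun c => d (c : E)) (fun c => rfl) x p
  have hp : eval₂ (algebraMap A E) x p = 0 := minpoly.aeval A x
  have hxC : x ∈ C := hC hx
  have hne : aeval x (derivative p) ≠ 0 :=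
    Separable.aeval_derivative_ne_zero (minpoly.irreducible hint).separable (minpoly.aeval A x)
  have hmem : aeval x (derivative p) ∈ C := by
    rw [aeval_eq_sum_range]
    refine C.sum_mem fun i _ => ?_
    rw [Algebra.smul_def]
    exact C.mul_mem (hC' (SetLike.coe_mem _)) (C.pow_mem hxC i)
  have hsum : p.sum (fun i c => d (c : E) * x ^ i) ∈ V := by
    rw [Polynomial.sum]
    refine V.sum_mem fun i _ => ?_
    rw [mul_comm]
    exact hV _ (C.pow_mem hxC i) _ (hA _ (SetLike.coe_mem _))
  rw [hp, map_zero] at h0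
  change 0 = _ + d x * aeval x (derivative p) at h0
  have : d x = (aeval x (derivative p))⁻¹ * -p.sum (fun i c => d (c : E) * x ^ i) := by
    rw [eq_inv_mul_iff_mul_eq₀ hne]
    linear_combination -h0
  rw [this]
  exact hV _ (C.inv_mem hmem) _ (V.neg_mem hsum)

lemma deriv_mem_acl [CharZero E] {S T : Set E} (hST : S ⊆ acl F T)
    (hF : ∀ c, d (algebraMap F E c) ∈ acl F T) (hS : ∀ s ∈ S, d s ∈ acl F T)
    {x : E} (hx : x ∈ acl F S) : d x ∈ acl F T :=
  mem_aclField.1 <| deriv_mem_of_mem_acl (C := aclField F T)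
    (V := (aclField F T).toAddSubgroup) (fun _ hc _ hv => (aclField F T).mul_mem hc hv)
    (fun _ h => mem_aclField.2 (acl_subset_acl hST h)) (fun c => mem_aclField.2 (hF c))
    (fun s hs => mem_aclField.2 (hS s hs)) hx

lemma deriv_eq_zero_of_mem_acl [CharZero E] {S : Set E}
    (hF : ∀ c, d (algebraMap F E c) = 0) (hS : ∀ s ∈ S, d s = 0)
    {x : E} (hx : x ∈ acl F S) : d x = 0 := by
  have := deriv_mem_of_mem_acl (d := d) (C := ⊤) (V := (⊥ : AddSubgroup E)) (F := F) (S := S)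
    (fun _ _ v hv => by simp_all) (fun _ _ => trivial) (by simpa using hF) (by simpa using hS) hx
  simpa using this

end Deriv

section Transcendence

lemma exists_eval₂_eq_zero_of_isAlgebraic {R A : Type*} [CommRing R] [CommRing A] [Algebra A E]
    (f : R →+* E) (hA : Function.Injective (algebraMap A E))
    (hf : ∀ a : A, algebraMap A E a ∈ f.range) {x : E} (hx : IsAlgebraic A x) :
    ∃ Q : R[X], Q ≠ 0 ∧ eval₂ f x Q = 0 := by
  obtain ⟨p, hp, hp0⟩ := hx
  obtain ⟨Q, hQ⟩ := (lifts_iff_coeff_lifts (f := f) (p.map (algebraMap A E))).2 fun n => by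
    rw [coeff_map]; exact hf _
  refine ⟨Q, ?_, ?_⟩
  · rintro rfl
    rw [coe_mapRingHom, Polynomial.map_zero, eq_comm, Polynomial.map_eq_zero_iff hA] at hQ
    exact hp hQ
  · rw [coe_mapRingHom] at hQ
    rw [← eval_map, hQ, eval_map_algebraMap, hp0]

variable (F) in
/-- The generators `S` and the coefficients `F` generate a field stable under `d`. -/
structure IsStable (d : Deriv E) (S : Set E) : Prop where
  algebraMap_mem (c : F) : d (algebraMap F E c) ∈ adjoin F S
  mem (s : E) (hs : s ∈ S) : d s ∈ adjoin F S

variable (F) in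
/-- `F` is a field of coefficients for the second Painlevé equation with parameter `α ∉ ℚ`. -/
structure IsPainleveBase (d : Deriv E) (t α : E) : Prop where
  stable : IsStable F d ∅
  mem_t : t ∈ adjoin F (∅ : Set E)
  mem_α : α ∈ adjoin F (∅ : Set E)
  deriv_t : d t = 1
  deriv_α : d α = 0
  ne_ratCast (q : ℚ) : α ≠ q

/-- `z` solves the second Painlevé equation. -/
def IsSolution (d : Deriv E) (t α z : E) : Prop := d (d z) = 2 * z ^ 3 + t * z + α

variable {d : Deriv E} {S : Set E} {t α z : E}

lemma adjoin_empty_le (S : Set E) : adjoin F (∅ : Set E) ≤ adjoin F S :=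
  adjoin.mono F _ _ (Set.empty_subset S)

lemma IsStable.deriv_mem_adjoin (hS : IsStable F d S) {a : E} (ha : a ∈ adjoin F S) :
    d a ∈ adjoin F S :=
  deriv_mem_of_mem_adjoin (V := (adjoin F S).toSubfield.toAddSubgroup)
    (C := (adjoin F S).toSubfield) (fun _ hc _ hv => (adjoin F S).mul_mem hc hv)
    subset_rfl hS.algebraMap_mem hS.mem ha

lemma IsStable.deriv_mem_acl [CharZero E] (hS : IsStable F d S) {a : E} (ha : a ∈ acl F S) :
    d a ∈ acl F S :=
  PainleveII.deriv_mem_acl (subset_acl S) (fun c => adjoin_subset_acl _ (hS.algebraMap_mem c))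
    (fun s hs => adjoin_subset_acl _ (hS.mem s hs)) ha

lemma IsStable.union_pair (hS : IsStable F d S)
    (hz : d (d z) ∈ adjoin F (S ∪ {z, d z})) : IsStable F d (S ∪ {z, d z}) where
  algebraMap_mem c := adjoin.mono F _ _ Set.subset_union_left (hS.algebraMap_mem c)
  mem := by
    rintro s (hs | rfl | rfl)
    · exact adjoin.mono F _ _ Set.subset_union_left (hS.mem s hs)
    · exact subset_adjoin F _ (by simp)
    · exact hz

lemma IsPainleveBase.stable_union (h : IsPainleveBase F d t α) (hS : IsStable F d S)
    (hz : IsSolution d t α z) : IsStable F d (S ∪ {z, d z}) := by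
  refine hS.union_pair ?_
  have hz' : z ∈ adjoin F (S ∪ {z, d z}) := subset_adjoin F _ (by simp)
  rw [hz]
  exact add_mem (add_mem (mul_mem (ofNat_mem _ 2) (pow_mem hz' 3))
    (mul_mem (adjoin_empty_le _ h.mem_t) hz')) (adjoin_empty_le _ h.mem_α)

/-- The restriction of a derivation to a stable field. -/
def IsStable.restrict (hS : IsStable F d S) : Deriv (adjoin F S) where
  toFun a := ⟨d a, hS.deriv_mem_adjoin a.2⟩
  map_zero' := by ext; simp
  map_add' a b := by ext; simp
  leibniz' a b := by ext; exact d.leibniz a b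

lemma eval₂RingHom_injective_of_not_mem_acl (hz : z ∉ acl F S) :
    Function.Injective (eval₂RingHom (algebraMap (adjoin F S) E) z) := by
  rw [injective_iff_map_eq_zero]
  intro p hp
  by_contra hp0
  exact hz ⟨p, hp0, hp⟩

variable [CharZero E]

/-- A solution transcendental over a differential field is transcendental of order two. -/
lemma IsPainleveBase.deriv_not_mem_acl (h : IsPainleveBase F d t α) (hS : IsStable F d S)
    (hz : IsSolution d t α z) (hzS : z ∉ acl F S) : d z ∉ acl F (S ∪ {z}) := by
  intro hmem
  have := eval_deriv_injective (algebraMap (adjoin F S) E) (δ := hS.restrict) (d := d)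
    (fun c => rfl) (t := ⟨t, adjoin_empty_le S h.mem_t⟩) (α := ⟨α, adjoin_empty_le S h.mem_α⟩)
    (Subtype.ext h.deriv_t) (Subtype.ext h.deriv_α)
    (fun q hq => h.ne_ratCast q (by simpa using congrArg (algebraMap (adjoin F S) E) hq)) hz
    (eval₂RingHom_injective_of_not_mem_acl hzS)
  obtain ⟨Q, hQ, hQ0⟩ := exists_eval₂_eq_zero_of_isAlgebraic
    (eval₂RingHom (algebraMap (adjoin F S) E) z) Subtype.val_injective (fun a => by
      have : Algebra.adjoin (adjoin F S) {z} ≤ (aeval z : (adjoin F S)[X] →ₐ[adjoin F S] E).range :=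
        Algebra.adjoin_le (by rintro _ rfl; exact ⟨X, by simp⟩)
      exact this a.2) (mem_acl_iff.1 ((acl_adjoin S _).ge hmem))
  exact hQ ((injective_iff_map_eq_zero _).1 this Q hQ0)

/-- The linearised equation at a transcendental solution `z` has no logarithmic derivative of a
solution algebraic over the differential field generated by `z`. -/
lemma IsPainleveBase.riccati_not_mem_acl (h : IsPainleveBase F d t α) (hS : IsStable F d S)
    (hz : IsSolution d t α z) (hzS : z ∉ acl F S) {v : E} (hv : d v = 6 * z ^ 2 + t - v ^ 2) :
    v ∉ acl F (S ∪ {z, d z}) := by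
  intro hmem
  have := eval_riccati_injective (algebraMap (adjoin F S) E) (δ := hS.restrict) (d := d)
    (fun c => rfl) (t := ⟨t, adjoin_empty_le S h.mem_t⟩) (α := ⟨α, adjoin_empty_le S h.mem_α⟩)
    (Subtype.ext h.deriv_t) (Subtype.ext h.deriv_α)
    (fun q hq => h.ne_ratCast q (by simpa using congrArg (algebraMap (adjoin F S) E) hq)) hz hv
    (eval₂RingHom_injective_of_not_mem_acl hzS)
  obtain ⟨Q, hQ, hQ0⟩ := exists_eval₂_eq_zero_of_isAlgebraic
    (eval₂RingHom (eval₂RingHom (algebraMap (adjoin F S) E) z) (d z))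
    Subtype.val_injective (fun a => by
      obtain ⟨a, ha⟩ := a
      change a ∈ _
      induction ha using Algebra.adjoin_induction with
      | mem x hx =>
        rcases hx with rfl | rfl
        · exact ⟨C X, by simp⟩
        · exact ⟨X, by simp⟩
      | algebraMap c => exact ⟨C (C c), by simp⟩
      | add x y _ _ hx hy => exact add_mem hx hy
      | mul x y _ _ hx hy => exact mul_mem hx hy) (mem_acl_iff.1 ((acl_adjoin S _).ge hmem))
  exact hQ ((injective_iff_map_eq_zero _).1 this Q hQ0)

end Transcendence
end Acl

section Extension
variable {F E : Type*} [Field F] [Field E] [Algebra F E]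

lemma exists_ringHom_lift {A B T : Type*} [CommRing A] [CommRing B] [CommRing T] [Algebra A B]
    [Algebra.FormallySmooth A B] (π : T →+* B) (hπ : Function.Surjective π)
    (hker : IsNilpotent (RingHom.ker π)) (φ : A →+* T) (hφ : ∀ a, π (φ a) = algebraMap A B a) :
    ∃ ψ : B →+* T, (∀ b, π (ψ b) = b) ∧ ∀ a, ψ (algebraMap A B a) = φ a := by
  let := φ.toAlgebra
  let g : T →ₐ[A] B := { π with commutes' := hφ }
  let ψ := Algebra.FormallySmooth.liftOfSurjective (AlgHom.id A B) g hπ hker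
  exact ⟨ψ, fun b => Algebra.FormallySmooth.liftOfSurjective_apply (AlgHom.id A B) g hπ hker b,
    fun a => ψ.commutes a⟩

open scoped IntermediateField.algebraAdjoinAdjoin in
lemma formallySmooth_adjoin_of_isTranscendenceBasis [CharZero F] {ι : Type*} {b : ι → E}
    (hb : IsTranscendenceBasis F b) :
    Algebra.FormallySmooth (Algebra.adjoin F (Set.range b)) E := by
  have : Algebra.FormallySmooth (Algebra.adjoin F (Set.range b))
      (IntermediateField.adjoin F (Set.range b)) := .of_isLocalization (nonZeroDivisors _)
  have := hb.isAlgebraic_field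
  have : Algebra.FormallyEtale (IntermediateField.adjoin F (Set.range b)) E :=
    Algebra.FormallyEtale.of_isSeparable _ E
  exact .comp _ (IntermediateField.adjoin F (Set.range b)) _

/-- A derivation `F → E` extends to `E`, with arbitrary values on an algebraically independent
family. -/
lemma exists_deriv_extension [CharZero F] (δ : F →+ E)
    (hδ : ∀ a b, δ (a * b) = algebraMap F E a * δ b + algebraMap F E b * δ a)
    {ι : Type*} {u : ι → E} (hu : AlgebraicIndependent F u) (v : ι → E) :
    ∃ d : Deriv E, (∀ c, d (algebraMap F E c) = δ c) ∧ ∀ i, d (u i) = v i := by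
  classical
  obtain ⟨B, huB, hB⟩ := exists_isTranscendenceBasis_superset hu.to_subtype_range
  have := formallySmooth_adjoin_of_isTranscendenceBasis hB
  have δ1 : δ 1 = 0 := by simpa using hδ 1 1
  let φ₀ : F →+* TrivSqZeroExt E E :=
    { toFun := fun c => TrivSqZeroExt.inl (algebraMap F E c) + TrivSqZeroExt.inr (δ c)
      map_one' := by ext <;> simp [δ1]
      map_zero' := by ext <;> simp
      map_add' := fun a b => by ext <;> simp
      map_mul' := fun a b => by ext <;> simp [hδ, mul_comm] }
  let φ₁ : MvPolynomial B F →+* TrivSqZeroExt E E := MvPolynomial.eval₂Hom φ₀ fun x =>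
    TrivSqZeroExt.inl (x : E) + TrivSqZeroExt.inr (Function.extend u v 0 x)
  let π : TrivSqZeroExt E E →+* E := (TrivSqZeroExt.fstHom E E E).toRingHom
  let e := hB.1.aevalEquiv
  have hφ₁ : ∀ p, π (φ₁ p) = MvPolynomial.aeval ((↑) : B → E) p := by
    intro p
    have : π.comp φ₁ = (MvPolynomial.aeval ((↑) : B → E) : MvPolynomial B F →ₐ[F] E) := by
      refine MvPolynomial.ringHom_ext (fun c => ?_) fun i => ?_
      · simp [φ₁, φ₀, π]
      · simp [φ₁, π]
    exact RingHom.congr_fun this p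
  obtain ⟨ψ, h1, h2⟩ := exists_ringHom_lift π (fun x => ⟨TrivSqZeroExt.inl x, by simp [π]⟩)
    ⟨2, TrivSqZeroExt.kerIdeal_sq E E⟩ (φ₁.comp e.symm.toRingEquiv.toRingHom) (fun a => by
      obtain ⟨p, rfl⟩ := e.surjective a
      simp only [RingHom.comp_apply]
      refine (congrArg (fun q => π (φ₁ q)) (e.symm_apply_apply p)).trans ?_
      rw [hφ₁]
      exact (hB.1.algebraMap_aevalEquiv p).symm)
  have h3 : ∀ p, ψ (MvPolynomial.aeval ((↑) : B → E) p) = φ₁ p := by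
    intro p
    have := h2 (e p)
    rw [hB.1.algebraMap_aevalEquiv] at this
    rw [this]
    exact congrArg φ₁ (e.symm_apply_apply p)
  have h1' : ∀ b, (ψ b).fst = b := h1
  refine ⟨
    { toFun := fun x => (ψ x).snd
      map_zero' := by simp
      map_add' := by simp
      leibniz' := by simp [h1', mul_comm] }, fun c => ?_, fun i => ?_⟩
  · change (ψ (algebraMap F E c)).snd = δ c
    have := h3 (MvPolynomial.C c)
    simp only [MvPolynomial.aeval_C] at this
    rw [this]
    simp [φ₁, φ₀]
  · change (ψ (u i)).snd = v i
    have := h3 (MvPolynomial.X ⟨u i, huB ⟨i, rfl⟩⟩)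
    simp only [MvPolynomial.aeval_X] at this
    rw [this]
    simp [φ₁, hu.injective.extend_apply]

end Extension

section Key
variable {F E : Type*} [Field F] [Field E] [Algebra F E]
open IntermediateField

/-- The commutator of two derivations. -/
def Deriv.commutator (d₁ d₂ : Deriv E) : Deriv E where
  toFun x := d₁ (d₂ x) - d₂ (d₁ x)
  map_zero' := by simp
  map_add' x y := by simp only [map_add]; ring
  leibniz' x y := by simp only [Deriv.leibniz, map_add]; ring

lemma Deriv.commutator_apply (d₁ d₂ : Deriv E) (x : E) :
    d₁.commutator d₂ x = d₁ (d₂ x) - d₂ (d₁ x) := rfl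

lemma Deriv.map_painleve (d : Deriv E) {t α : E} (ht : d t = 0) (hα : d α = 0) (x : E) :
    d (2 * x ^ 3 + t * x + α) = (6 * x ^ 2 + t) * d x := by
  simp only [map_add, Deriv.leibniz, Deriv.leibniz_pow, ht, hα, Deriv.map_ofNat]
  push_cast
  ring

/-- There is no nontrivial algebraic relation between three solutions whose pairs are independent;
`w` is a generic solution of the linearised equation at `y`. -/
lemma IsPainleveBase.no_ternary_relation [CharZero E] {D : Deriv E} {S : Set E} {t α x y z w : E}
    (h : IsPainleveBase F D t α) (hS : IsStable F D S) (hx : IsSolution D t α x)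
    (hy : IsSolution D t α y) (hz : IsSolution D t α z) (hw : D (D w) = (6 * y ^ 2 + t) * w)
    (hw0 : w ≠ 0) (hzcl : z ∈ acl F (S ∪ {x, D x} ∪ {y, D y}))
    (hxcl : x ∈ acl F (S ∪ {z, D z} ∪ {y, D y})) (hycl : y ∈ acl F (S ∪ {z, D z} ∪ {x, D x}))
    (hxw : x ∉ acl F (S ∪ {y, D y} ∪ {w, D w})) (hyz : y ∉ acl F (S ∪ {z, D z})) : False := by
  have hSz := h.stable_union hS hz
  have hind : AlgebraicIndependent (adjoin F (S ∪ {z, D z})) ![y, D y] := by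
    rw [algebraicIndependent_pair_iff, acl_adjoin, acl_adjoin, Set.union_empty]
    exact ⟨hyz, h.deriv_not_mem_acl hSz hy hyz⟩
  obtain ⟨d, hd0, hdv⟩ := exists_deriv_extension (0 : adjoin F (S ∪ {z, D z}) →+ E) (by simp)
    hind ![w, D w]
  have hd : ∀ a ∈ adjoin F (S ∪ {z, D z}), d a = 0 := fun a ha => hd0 ⟨a, ha⟩
  have hdF : ∀ c : F, d (algebraMap F E c) = 0 := fun c => hd _ (_root_.algebraMap_mem _ c)
  have hds : ∀ s ∈ S ∪ {z, D z}, d s = 0 := fun s hs => hd _ (subset_adjoin F _ hs)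
  have hdy : d y = w := hdv 0
  have hdy' : d (D y) = D w := hdv 1
  have hdt : d t = 0 := hd _ (adjoin_empty_le _ h.mem_t)
  have hdα : d α = 0 := hd _ (adjoin_empty_le _ h.mem_α)
  set A : Set E := S ∪ {z, D z} ∪ {y, D y} with hA
  have hcomm : ∀ a ∈ acl F A, D (d a) = d (D a) := by
    intro a ha
    rw [← sub_eq_zero, ← Deriv.commutator_apply]
    refine deriv_eq_zero_of_mem_acl (fun c => ?_) ?_ ha
    · rw [Deriv.commutator_apply, hdF, map_zero, hd _ (hSz.algebraMap_mem c), sub_zero]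
    · rintro s (hs | rfl | rfl)
      · rw [Deriv.commutator_apply, hds s hs, map_zero, hd _ (hSz.mem s hs), sub_zero]
      · rw [Deriv.commutator_apply, hdy, hdy', sub_self]
      · rw [Deriv.commutator_apply, hdy', hw, hy, Deriv.map_painleve d hdt hdα, hdy, sub_self]
  have hDx : D x ∈ acl F A := (h.stable_union hSz hy).deriv_mem_acl hxcl
  have hβ : D (d x) = d (D x) := hcomm _ hxcl
  have hβ2 : D (D (d x)) = (6 * x ^ 2 + t) * d x := by
    rw [hβ, hcomm _ hDx, hx, Deriv.map_painleve d hdt hdα]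
  have hβ0 : d x ≠ 0 := by
    intro h0
    refine hw0 (hdy ▸ deriv_eq_zero_of_mem_acl hdF ?_ hycl)
    rintro s (hs | rfl | rfl)
    · exact hds s hs
    · exact h0
    · rw [← hβ, h0, map_zero]
  set T : Set E := S ∪ {y, D y} ∪ {w, D w} ∪ {x, D x} with hT
  have hsub : S ∪ {x, D x} ∪ {y, D y} ⊆ T := by
    rintro s ((hs | rfl | rfl) | rfl | rfl) <;> simp_all
  have hDz : D z ∈ acl F (S ∪ {x, D x} ∪ {y, D y}) :=
    (h.stable_union (h.stable_union hS hx) hy).deriv_mem_acl hzcl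
  have h0T : (0 : E) ∈ acl F T := adjoin_subset_acl _ (zero_mem _)
  have hdA : ∀ a ∈ acl F A, d a ∈ acl F T := by
    refine fun a ha => deriv_mem_acl ?_ (fun c => by rw [hdF]; exact h0T) ?_ ha
    · rintro s ((hs | rfl | rfl) | rfl | rfl)
      · exact subset_acl _ (hsub (by simp [hs]))
      · exact acl_mono hsub hzcl
      · exact acl_mono hsub hDz
      · exact subset_acl _ (by simp [hT])
      · exact subset_acl _ (by simp [hT])
    · rintro s (hs | rfl | rfl)
      · rw [hds s hs]; exact h0T
      · rw [hdy]; exact subset_acl _ (by simp [hT])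
      · rw [hdy']; exact subset_acl _ (by simp [hT])
  refine h.riccati_not_mem_acl (v := D (d x) / d x)
    ((h.stable_union hS hy).union_pair ?_) hx hxw ?_ ?_
  · rw [hw]
    have hy' : y ∈ adjoin F (S ∪ {y, D y} ∪ {w, D w}) := subset_adjoin F _ (by simp)
    exact mul_mem (add_mem (mul_mem (ofNat_mem _ 6) (pow_mem hy' 2))
      (adjoin_empty_le _ h.mem_t)) (subset_adjoin F _ (by simp))
  · rw [div_eq_mul_inv, Deriv.leibniz, Deriv.map_inv, hβ2]
    field_simp
    ring
  · rw [hβ]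
    exact mem_aclField.1 (div_mem (mem_aclField.2 (hdA _ hDx)) (mem_aclField.2 (hdA _ hxcl)))

end Key

section Triviality
variable {K L : Type*} [Field K] [Field L] [Algebra K L]
open IntermediateField

lemma IsStable.map {E : Type*} [Field E] [Algebra K E] [Algebra L E] [IsScalarTower K L E]
    {D : Deriv L} {D' : Deriv E} (hD : ∀ a, D' (algebraMap L E a) = algebraMap L E (D a))
    {S : Set L} (hS : IsStable K D S) : IsStable K D' (algebraMap L E '' S) := by
  have he : ∀ a ∈ adjoin K S, algebraMap L E a ∈ adjoin K (algebraMap L E '' S) := by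
    intro a ha
    have := adjoin_map K S (IsScalarTower.toAlgHom K L E)
    exact this.le ⟨a, ha, rfl⟩
  constructor
  · intro c
    rw [IsScalarTower.algebraMap_apply K L E, hD]
    exact he _ (hS.algebraMap_mem c)
  · rintro _ ⟨s, hs, rfl⟩
    rw [hD]
    exact he _ (hS.mem s hs)

lemma IsPainleveBase.map {E : Type*} [Field E] [Algebra K E] [Algebra L E] [IsScalarTower K L E]
    {D : Deriv L} {D' : Deriv E} (hD : ∀ a, D' (algebraMap L E a) = algebraMap L E (D a))
    {t α : L} (h : IsPainleveBase K D t α) :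
    IsPainleveBase K D' (algebraMap L E t) (algebraMap L E α) := by
  have he : ∀ a ∈ adjoin K (∅ : Set L), algebraMap L E a ∈ adjoin K (∅ : Set E) := by
    intro a ha
    have := adjoin_map K ∅ (IsScalarTower.toAlgHom K L E)
    rw [Set.image_empty] at this
    exact this.le ⟨a, ha, rfl⟩
  exact {
    stable := by simpa using h.stable.map hD
    mem_t := he _ h.mem_t
    mem_α := he _ h.mem_α
    deriv_t := by rw [hD, h.deriv_t, _root_.map_one]
    deriv_α := by rw [hD, h.deriv_α, map_zero]
    ne_ratCast := fun q hq => h.ne_ratCast q ((algebraMap L E).injective (by simpa using hq)) }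

lemma IsSolution.map {E : Type*} [Field E] [Algebra L E]
    {D : Deriv L} {D' : Deriv E} (hD : ∀ a, D' (algebraMap L E a) = algebraMap L E (D a))
    {t α x : L} (hx : IsSolution D t α x) :
    IsSolution D' (algebraMap L E t) (algebraMap L E α) (algebraMap L E x) := by
  unfold IsSolution at *
  rw [hD, hD, hx]
  simp only [map_add, map_mul, map_pow, map_ofNat]

lemma map_not_mem_acl_pair {E : Type*} [Field E] [Algebra K E] [Algebra L E] [IsScalarTower K L E]
    {S : Set L} {x : L} (hx : x ∉ acl K S) {u v : E} (huv : AlgebraicIndependent L ![u, v]) :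
    algebraMap L E x ∉ acl K (algebraMap L E '' S ∪ {u, v}) := by
  obtain ⟨hu, hv⟩ := algebraicIndependent_pair_iff.1 huv
  have hx1 : algebraMap L E x ∉ acl K (insert u (algebraMap L E '' S)) := by
    intro h
    refine hu (acl_union_range_subset (F := K) ∅ (acl_mono ?_ (mem_acl_insert_of_mem h ?_)))
    · rintro _ (rfl | ⟨s, -, rfl⟩) <;> simp
    · rwa [map_mem_acl_iff]
  intro h
  have h' : algebraMap L E x ∈ acl K (insert v (insert u (algebraMap L E '' S))) :=
    acl_mono (by rintro _ (⟨s, hs, rfl⟩ | rfl | rfl) <;> simp_all) h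
  refine hv (acl_union_range_subset (F := K) {u} (acl_mono ?_ (mem_acl_insert_of_mem h' hx1)))
  rintro _ (rfl | rfl | ⟨s, -, rfl⟩) <;> simp

section SolutionSet
variable {ι : Type*} {D : Deriv L} {Y : ι → L}

/-- The members of `Y` with index in `s`, together with their derivatives. -/
def solutionSet (D : Deriv L) (Y : ι → L) (s : Finset ι) : Set L :=
  {a | ∃ i ∈ s, a = Y i ∨ a = D (Y i)}

lemma solutionSet_empty : solutionSet D Y ∅ = ∅ := by
  ext a; simp [solutionSet]

lemma solutionSet_insert [DecidableEq ι] (s : Finset ι) (i : ι) :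
    solutionSet D Y (insert i s) = solutionSet D Y s ∪ {Y i, D (Y i)} := by
  ext a
  simp only [solutionSet, Finset.mem_insert, Set.mem_ofPred_eq, Set.mem_union,
    Set.mem_insert_iff, Set.mem_singleton_iff, or_and_right, exists_or, exists_eq_left]
  exact or_comm

lemma IsPainleveBase.stable_solutionSet [DecidableEq ι] {t α : L}
    (h : IsPainleveBase K D t α)
    (hY : ∀ i, IsSolution D t α (Y i)) (s : Finset ι) : IsStable K D (solutionSet D Y s) := by
  induction s using Finset.induction_on with
  | empty => rw [solutionSet_empty]; exact h.stable
  | insert i s _ ih => rw [solutionSet_insert]; exact h.stable_union ih (hY i)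

end SolutionSet

variable [CharZero L] {D : Deriv L} {S : Set L} {t α x y z : L}

lemma IsPainleveBase.exchange (h : IsPainleveBase K D t α) (hS : IsStable K D S)
    (hx : IsSolution D t α x) (hz : IsSolution D t α z) (hzS : z ∉ acl K S)
    (hzx : z ∈ acl K (S ∪ {x, D x})) : x ∈ acl K (S ∪ {z, D z}) := by
  by_cases h1 : z ∈ acl K (insert x S)
  · exact acl_mono (by rintro s (rfl | hs) <;> simp_all) (mem_acl_insert_of_mem h1 hzS)
  · have h2 : D x ∈ acl K (insert z (insert x S)) := by
      refine mem_acl_insert_of_mem (acl_mono ?_ hzx) h1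
      rintro s (hs | rfl | rfl) <;> simp_all
    by_contra hcon
    refine h.deriv_not_mem_acl (h.stable_union hS hz) hx hcon (acl_mono ?_ h2)
    rintro s (rfl | rfl | hs) <;> simp_all

lemma IsPainleveBase.not_mem_acl_of_pairs (h : IsPainleveBase K D t α) (hS : IsStable K D S)
    (hx : IsSolution D t α x) (hy : IsSolution D t α y) (hz : IsSolution D t α z)
    (hzx : z ∉ acl K (S ∪ {x, D x})) (hzy : z ∉ acl K (S ∪ {y, D y}))
    (hxy : x ∉ acl K (S ∪ {y, D y})) (hyz : y ∉ acl K (S ∪ {z, D z})) :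
    z ∉ acl K (S ∪ {x, D x} ∪ {y, D y}) := by
  intro hzcl
  have hycl := h.exchange (h.stable_union hS hx) hy hz hzx hzcl
  have hxcl := h.exchange (h.stable_union hS hy) hx hz hzy (by rwa [Set.union_right_comm])
  rw [Set.union_right_comm] at hxcl hycl
  let E := FractionRing (MvPolynomial (Fin 2) L)
  let φ : MvPolynomial (Fin 2) L →ₐ[L] E := IsScalarTower.toAlgHom L _ E
  have hX : AlgebraicIndependent L (φ ∘ MvPolynomial.X) :=
    (MvPolynomial.algebraicIndependent_X (Fin 2) L).map' (IsFractionRing.injective _ E)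
  set w : E := φ (MvPolynomial.X 0) with hwdef
  set w' : E := φ (MvPolynomial.X 1) with hwdef'
  have hind : AlgebraicIndependent L ![w, w'] := by
    convert hX using 1
    ext i
    fin_cases i <;> rfl
  obtain ⟨D', hD, hD'⟩ := exists_deriv_extension ((algebraMap L E : L →+ E).comp D.toAddMonoidHom)
    (fun a b => by
      change algebraMap L E (D (a * b)) = _ * algebraMap L E (D b) + _ * algebraMap L E (D a)
      rw [Deriv.leibniz]
      simp) hind ![w', (6 * algebraMap L E y ^ 2 + algebraMap L E t) * w]
  replace hD : ∀ a, D' (algebraMap L E a) = algebraMap L E (D a) := hD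
  have hDw : D' w = w' := hD' 0
  have hDw' : D' w' = (6 * algebraMap L E y ^ 2 + algebraMap L E t) * w := hD' 1
  have : CharZero E := charZero_of_injective_algebraMap (algebraMap L E).injective
  have hset : ∀ a b : L, algebraMap L E '' S ∪ {algebraMap L E a, D' (algebraMap L E a)} ∪
      {algebraMap L E b, D' (algebraMap L E b)} =
      algebraMap L E '' (S ∪ {a, D a} ∪ {b, D b}) := fun a b => by
    rw [Set.image_union, Set.image_union, Set.image_pair, Set.image_pair, hD, hD]
  have hset' : ∀ a : L, algebraMap L E '' S ∪ {algebraMap L E a, D' (algebraMap L E a)} =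
      algebraMap L E '' (S ∪ {a, D a}) := fun a => by
    rw [Set.image_union, Set.image_pair, hD]
  refine (h.map hD).no_ternary_relation (hS.map hD) (hx.map hD) (hy.map hD) (hz.map hD)
    (w := w) (by rw [hDw, hDw']) ?_ ?_ ?_ ?_ ?_ ?_
  · exact hind.ne_zero 0
  · rwa [hset, map_mem_acl_iff]
  · rwa [hset, map_mem_acl_iff]
  · rwa [hset, map_mem_acl_iff]
  · rw [hset', hDw]
    exact map_not_mem_acl_pair hxy hind
  · rwa [hset', map_mem_acl_iff]

section Family
variable {ι : Type*} [DecidableEq ι] {Y : ι → L}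

lemma IsPainleveBase.not_mem_acl_solutionSet (h : IsPainleveBase K D t α)
    (hY : ∀ i, IsSolution D t α (Y i))
    (hpair : ∀ i j, i ≠ j → Y i ∉ acl K {Y j, D (Y j)}) (s : Finset ι) (hs : s.Nonempty) (i : ι)
    (hi : i ∉ s) : Y i ∉ acl K (solutionSet D Y s) := by
  induction hn : s.card using Nat.strong_induction_on generalizing s i with
  | _ n ih =>
  obtain ⟨a, ha⟩ := hs
  obtain ⟨s, has, rfl⟩ : ∃ s', a ∉ s' ∧ s = insert a s' :=
    ⟨s.erase a, by simp, (Finset.insert_erase ha).symm⟩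
  rcases s.eq_empty_or_nonempty with rfl | ⟨b, hb⟩
  · rw [solutionSet_insert, solutionSet_empty, Set.empty_union]
    exact hpair _ _ (by simpa using hi)
  obtain ⟨s, hbs, rfl⟩ : ∃ s', b ∉ s' ∧ s = insert b s' :=
    ⟨s.erase b, by simp, (Finset.insert_erase hb).symm⟩
  have hlt : ∀ c, c ∉ s → (insert c s).card < n := fun c hc => by
    rw [← hn, Finset.card_insert_of_notMem has, Finset.card_insert_of_notMem hbs,
      Finset.card_insert_of_notMem hc]
    omega
  simp only [Finset.mem_insert, not_or] at hi has
  have key : ∀ j c, j ∉ s → c ∉ s → j ≠ c → Y j ∉ acl K (solutionSet D Y s ∪ {Y c, D (Y c)}) := by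
    intro j c hj hc hjc
    rw [← solutionSet_insert]
    exact ih _ (hlt c hc) _ ⟨c, by simp⟩ j (by simp [hj, hjc]) rfl
  rw [solutionSet_insert, solutionSet_insert]
  exact h.not_mem_acl_of_pairs (h.stable_solutionSet hY s) (hY b) (hY a) (hY i)
    (key _ _ hi.2.2 hbs hi.2.1) (key _ _ hi.2.2 has.2 hi.1) (key _ _ hbs has.2 (Ne.symm has.1))
    (key _ _ has.2 hi.2.2 (Ne.symm hi.1))

/-- Pairwise independent solutions are jointly independent, together with their derivatives. -/
lemma IsPainleveBase.algebraicIndependent [Fintype ι] [Nontrivial ι] (h : IsPainleveBase K D t α)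
    (hY : ∀ i, IsSolution D t α (Y i))
    (hpair : ∀ i j, i ≠ j → Y i ∉ acl K {Y j, D (Y j)}) :
    AlgebraicIndependent K (Sum.elim Y fun i => D (Y i)) := by
  have hmain : ∀ (s : Finset ι) (i : ι), i ∉ s → Y i ∉ acl K (solutionSet D Y s) := by
    intro s i hi
    rcases s.eq_empty_or_nonempty with rfl | hs
    · obtain ⟨j, hj⟩ := exists_ne i
      exact fun hmem => hpair i j hj.symm (acl_mono (by simp [solutionSet_empty]) hmem)
    · exact h.not_mem_acl_solutionSet hY hpair s hs i hi
  have : ∀ s : Finset ι, AlgebraicIndepOn K (Sum.elim Y fun i => D (Y i))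
      (Sum.inl '' (s : Set ι) ∪ Sum.inr '' (s : Set ι)) := by
    intro s
    induction s using Finset.induction_on with
    | empty =>
      simpa [AlgebraicIndepOn, algebraicIndependent_empty_type_iff] using
        (algebraMap K L).injective
    | insert i s hi ih =>
      have himg : (Sum.elim Y fun i => D (Y i)) ''
          (Sum.inl '' (s : Set ι) ∪ Sum.inr '' (s : Set ι)) ⊆ solutionSet D Y s := by
        rintro _ ⟨_, ⟨j, hj, rfl⟩ | ⟨j, hj, rfl⟩, rfl⟩
        · exact ⟨j, hj, Or.inl rfl⟩
        · exact ⟨j, hj, Or.inr rfl⟩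
      have hins : (Sum.inl '' ((insert i s : Finset ι) : Set ι) ∪
          Sum.inr '' ((insert i s : Finset ι) : Set ι) : Set (ι ⊕ ι)) =
          insert (Sum.inr i) (insert (Sum.inl i)
            (Sum.inl '' (s : Set ι) ∪ Sum.inr '' (s : Set ι))) := by
        ext (j | j) <;> simp
      rw [hins, algebraicIndepOn_insert_iff (by simpa using hi),
        algebraicIndepOn_insert_iff (by simpa using hi)]
      refine ⟨⟨ih, fun hmem => hmain s i hi (acl_mono himg hmem)⟩, fun hmem => ?_⟩
      refine h.deriv_not_mem_acl (h.stable_solutionSet hY s) (hY i) (hmain s i hi)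
        (acl_mono ?_ hmem)
      rw [Set.image_insert_eq]
      rintro a (rfl | ha)
      · simp
      · exact Or.inl (himg ha)
  have huniv := this Finset.univ
  rw [← AlgebraicIndepOn.univ]
  convert huniv
  ext (j | j) <;> simp

end Family
end Triviality

section Pair
variable {K L : Type*} [Field K] [Field L] [Algebra K L]

lemma not_mem_acl_of_algebraicIndependent {a a' b b' : L}
    (h : AlgebraicIndependent K ![a, a', b, b']) : a ∉ acl K {b, b'} ∧ b ∉ acl K {a, a'} := by
  have h1 := AlgebraicIndependent.transcendental_adjoin h (s := {2, 3}) (i := 0) (by simp)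
  have h2 := AlgebraicIndependent.transcendental_adjoin h (s := {0, 1}) (i := 2) (by simp)
  rw [Set.image_pair] at h1 h2
  rw [mem_acl_iff, mem_acl_iff]
  exact ⟨h1, h2⟩

end Pair

end PainleveII

/-- Geometric triviality of the generic second Painlevé equation (Proposition 3.6):
for `α ∈ ℂ` transcendental, if solutions `y₁, …, yₙ` of `y'' = 2y³ + ty + α` are such that
`y₁, y₁', …, yₙ, yₙ'` are algebraically dependent over a differential subfield `K`, then
already some pair `yᵢ, yᵢ', yⱼ, yⱼ'` (`i < j`) is algebraically dependent over `K`. -/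
theorem painleveII_geometrically_trivial
    (α : ℂ) (hα : Transcendental ℚ α)
    (L : Type*) [Field L] [Algebra ℂ L]
    (D : L → L)
    (hD_add : ∀ a b : L, D (a + b) = D a + D b)
    (hD_mul : ∀ a b : L, D (a * b) = a * D b + b * D a)
    (hD_const : ∀ c : ℂ, D (algebraMap ℂ L c) = 0)
    (t : L) (hDt : D t = 1)
    (K : Subfield L)
    (hK_const : ∀ c : ℂ, algebraMap ℂ L c ∈ K)
    (hK_t : t ∈ K)
    (hK_D : ∀ a ∈ K, D a ∈ K)
    (n : ℕ) (hn : 2 ≤ n)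
    (y : Fin n → L)
    (hsol : ∀ i : Fin n, D (D (y i)) = 2 * (y i) ^ 3 + t * y i + algebraMap ℂ L α)
    (hdep : ¬ AlgebraicIndependent K (Sum.elim y (fun i => D (y i)))) :
    ∃ i j : Fin n, i < j ∧
      ¬ AlgebraicIndependent K ![y i, D (y i), y j, D (y j)] := by
  by_contra! hcon
  let D' : PainleveII.Deriv L :=
    { toFun := D
      map_zero' := by simpa using hD_add 0 0
      map_add' := hD_add
      leibniz' := hD_mul }
  have : CharZero L := charZero_of_injective_algebraMap (algebraMap ℂ L).injective
  have : Nontrivial (Fin n) := Fin.nontrivial_iff_two_le.2 hn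
  have hmem : ∀ a ∈ K, a ∈ IntermediateField.adjoin K (∅ : Set L) := fun a ha =>
    (IntermediateField.adjoin K (∅ : Set L)).algebraMap_mem ⟨a, ha⟩
  have hbase : PainleveII.IsPainleveBase K D' t (algebraMap ℂ L α) :=
    { stable := ⟨fun c => hmem _ (hK_D c c.2), fun _ hs => absurd hs (Set.notMem_empty _)⟩
      mem_t := hmem t hK_t
      mem_α := hmem _ (hK_const α)
      deriv_t := hDt
      deriv_α := hD_const α
      ne_ratCast := fun q hq => by
        rw [← map_ratCast (algebraMap ℂ L) q] at hq
        rw [(algebraMap ℂ L).injective hq] at hα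
        exact hα (isAlgebraic_algebraMap q) }
  refine hdep (hbase.algebraicIndependent hsol fun i j hij => ?_)
  rcases lt_or_gt_of_ne hij with h | h
  · exact (PainleveII.not_mem_acl_of_algebraicIndependent (hcon i j h)).1
  · exact (PainleveII.not_mem_acl_of_algebraicIndependent (hcon j i h)).2
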